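/- arXiv:2110.15416 — 2 statements merged into one kernel-verified Lean document; each statement's English description precedes it below -/
import Mathlib

section
/- Let A_0+λE_0∈ℂ[λ]^{n×n} be the block bidiagonal pencil of the assumed form. Then A_0+λE_0 is regular and its only finite eigenvalue is 0. For 1≤j≤i≤k write Ẑ_{j:i−1}:=Ẑ_j Ẑ_{j+1}⋯Ẑ_{i−1}∈ℂ^{t_j×t_i}, with Ẑ_{i:i−1}:=I_{t_i}. For each i=1,…,k let Q_i(λ)∈ℂ[λ]^{n×(t_i−t_{i+1})} be the polynomial matrix whose j-th block row (of height t_j) equals λ^{j−1} Ẑ_{j:i−1} I_{t_i,t_{i+1}+1:t_i} for 1≤j≤i and is zero for i<j≤k. Then every column of Q_i(λ) is a root polynomial of order i at 0 for A_0+λE_0, and the t_1 columns of Q_k(λ),…,Q_1(λ) together form a maximal set of root polynomials at 0 for A_0+λE_0; in particular the nonzero partial multiplicities of A_0+λE_0 at 0 are exactly the numbers i repeated t_i−t_{i+1} times, i=1,…,k. -/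
open Polynomial Matrix

noncomputable section

/-- The matrix pencil `L₀ + λ L₁` viewed as a polynomial matrix. -/
def pencilMat {ι κ : Type*} (L0 L1 : Matrix ι κ ℂ) : Matrix ι κ (Polynomial ℂ) :=
  Matrix.of fun i j => Polynomial.C (L0 i j) + Polynomial.X * Polynomial.C (L1 i j)

/-- Entrywise evaluation of a polynomial matrix at a point. -/
def evalMat {ι κ : Type*} (P : Matrix ι κ (Polynomial ℂ)) (μ : ℂ) : Matrix ι κ ℂ :=
  P.map fun p => p.eval μ

/-- A polynomial matrix viewed over the field ℂ(λ) of rational functions. -/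
def toRat {ι κ : Type*} (P : Matrix ι κ (Polynomial ℂ)) : Matrix ι κ (RatFunc ℂ) :=
  P.map (algebraMap (Polynomial ℂ) (RatFunc ℂ))

/-- The normal rank of a polynomial matrix: its rank over ℂ(λ). -/
def normalRank {ι κ : Type*} [Fintype κ] (P : Matrix ι κ (Polynomial ℂ)) : ℕ :=
  (toRat P).rank

/-- The right nullspace of a polynomial matrix, as a ℂ(λ)-subspace of ℂ(λ)^κ. -/
def rightNullspace {ι κ : Type*} [Fintype κ] (P : Matrix ι κ (Polynomial ℂ)) :
    Submodule (RatFunc ℂ) (κ → RatFunc ℂ) :=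
  LinearMap.ker (toRat P).mulVecLin

/-- The degree of a polynomial (column) vector: maximum of the degrees of its entries. -/
def colDegree {ι : Type*} [Fintype ι] (v : ι → Polynomial ℂ) : ℕ :=
  Finset.univ.sup fun i => (v i).natDegree

/-- The columns of the polynomial matrix `N` form a minimal polynomial basis of the right
nullspace of `P`: they are a ℂ(λ)-basis of `rightNullspace P` and the sum of the column
degrees is minimal among all polynomial bases. -/
def IsMinimalBasis {ι κ : Type*} [Fintype ι] [Fintype κ] (P : Matrix ι κ (Polynomial ℂ))
    {p : ℕ} (N : Matrix κ (Fin p) (Polynomial ℂ)) : Prop :=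
  LinearIndependent (RatFunc ℂ) (fun j : Fin p => fun i : κ => toRat N i j) ∧
  Submodule.span (RatFunc ℂ) (Set.range fun j : Fin p => fun i : κ => toRat N i j)
    = rightNullspace P ∧
  ∀ M : Matrix κ (Fin p) (Polynomial ℂ),
    LinearIndependent (RatFunc ℂ) (fun j : Fin p => fun i : κ => toRat M i j) →
    Submodule.span (RatFunc ℂ) (Set.range fun j : Fin p => fun i : κ => toRat M i j)
      = rightNullspace P →
    (∑ j, colDegree fun i => N i j) ≤ ∑ j, colDegree fun i => M i j

/-- `x(λ)` is a right zero direction of order `k ≥ 1` for `P` at `λ₀`: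
`x(λ₀) ≠ 0` and `P(λ)x(λ) = (λ-λ₀)^k v(λ)` with `v` defined and nonzero at `λ₀`. -/
def IsZeroDirection {ι κ : Type*} [Fintype κ] (P : Matrix ι κ (Polynomial ℂ)) (lam0 : ℂ)
    (k : ℕ) (x : κ → Polynomial ℂ) : Prop :=
  0 < k ∧ (fun i => (x i).eval lam0) ≠ 0 ∧
  (∀ i, (Polynomial.X - Polynomial.C lam0) ^ k ∣ P.mulVec x i) ∧
  ¬ ∀ i, (Polynomial.X - Polynomial.C lam0) ^ (k + 1) ∣ P.mulVec x i

/-- `x(λ)` is a root polynomial of order (exactly) `k` at `λ₀` for `P`: it is a zero direction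
of order `k` and, for every right minimal basis `N` of `P`, `[N(λ₀) x(λ₀)]` has full column
rank. -/
def IsRootPoly {ι κ : Type*} [Fintype ι] [Fintype κ] (P : Matrix ι κ (Polynomial ℂ)) (lam0 : ℂ)
    (k : ℕ) (x : κ → Polynomial ℂ) : Prop :=
  IsZeroDirection P lam0 k x ∧
  ∀ (p : ℕ) (N : Matrix κ (Fin p) (Polynomial ℂ)), IsMinimalBasis P N →
    (Matrix.of fun (i : κ) (j : Sum (Fin p) (Fin 1)) =>
      Sum.elim (fun a => (N i a).eval lam0) (fun _ => (x i).eval lam0) j).rank = p + 1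

/-- `r 0, …, r (s-1)` is a `λ₀`-independent set of root polynomials of orders `k 0, …, k (s-1)`
for `P`: each is a root polynomial and `[N(λ₀) r₁(λ₀) … r_s(λ₀)]` has full column rank for
every right minimal basis `N`. -/
def IsIndepFamily {ι κ : Type*} [Fintype ι] [Fintype κ] (P : Matrix ι κ (Polynomial ℂ))
    (lam0 : ℂ) {s : ℕ} (k : Fin s → ℕ) (r : Fin s → κ → Polynomial ℂ) : Prop :=
  (∀ i, IsRootPoly P lam0 (k i) (r i)) ∧
  ∀ (p : ℕ) (N : Matrix κ (Fin p) (Polynomial ℂ)), IsMinimalBasis P N →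
    (Matrix.of fun (i : κ) (j : Sum (Fin p) (Fin s)) =>
      Sum.elim (fun a => (N i a).eval lam0) (fun b => (r b i).eval lam0) j).rank = p + s

/-- A complete set of root polynomials: a `λ₀`-independent set such that no `λ₀`-independent
set with more elements exists. -/
def IsCompleteFamily {ι κ : Type*} [Fintype ι] [Fintype κ] (P : Matrix ι κ (Polynomial ℂ))
    (lam0 : ℂ) {s : ℕ} (k : Fin s → ℕ) (r : Fin s → κ → Polynomial ℂ) : Prop :=
  IsIndepFamily P lam0 k r ∧
  ∀ (s' : ℕ) (k' : Fin s' → ℕ) (r' : Fin s' → κ → Polynomial ℂ),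
    IsIndepFamily P lam0 k' r' → s' ≤ s

/-- A maximal set of root polynomials at `λ₀`: complete, ordered (`k₁ ≥ … ≥ k_s > 0`), and for
every `j` there is no root polynomial of order `> k j` that stays `λ₀`-independent together
with `r₁, …, r_{j-1}`. -/
def IsMaximalFamily {ι κ : Type*} [Fintype ι] [Fintype κ] (P : Matrix ι κ (Polynomial ℂ))
    (lam0 : ℂ) {s : ℕ} (k : Fin s → ℕ) (r : Fin s → κ → Polynomial ℂ) : Prop :=
  IsCompleteFamily P lam0 k r ∧ Antitone k ∧ (∀ i, 0 < k i) ∧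
  ∀ (j : Fin s) (k' : ℕ), k j < k' → ∀ x : κ → Polynomial ℂ, IsRootPoly P lam0 k' x →
    ¬ ∀ (p : ℕ) (N : Matrix κ (Fin p) (Polynomial ℂ)), IsMinimalBasis P N →
      (Matrix.of fun (i : κ) (c : Sum (Fin p) (Fin ((j : ℕ) + 1))) =>
        Sum.elim (fun a => (N i a).eval lam0)
          (fun b => if h : (b : ℕ) < (j : ℕ) then (r ⟨(b : ℕ), h.trans j.isLt⟩ i).eval lam0
                    else (x i).eval lam0) c).rank = p + (j : ℕ) + 1

/-- `σ 0 ≤ … ≤ σ (r-1)` are the partial multiplicities of `P` at `λ₀`: there is a local Smith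
form `M(λ) P(λ) N(λ) = diag((λ-λ₀)^{σ i}) ⊕ 0` (up to positioning of the diagonal) with `M`,
`N` polynomial and invertible at `λ₀`. -/
def HasPartialMultiplicities {ι κ : Type*} [Fintype ι] [Fintype κ] [DecidableEq ι]
    [DecidableEq κ] (P : Matrix ι κ (Polynomial ℂ)) (lam0 : ℂ) {r : ℕ} (σ : Fin r → ℕ) : Prop :=
  Monotone σ ∧
  ∃ (M : Matrix ι ι (Polynomial ℂ)) (N : Matrix κ κ (Polynomial ℂ))
    (fR : Fin r → ι) (fC : Fin r → κ),
    Function.Injective fR ∧ Function.Injective fC ∧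
    (evalMat M lam0).det ≠ 0 ∧ (evalMat N lam0).det ≠ 0 ∧
    M * P * N = Matrix.of fun i j =>
      ∑ a : Fin r, if i = fR a ∧ j = fC a then (Polynomial.X - Polynomial.C lam0) ^ σ a else 0

/-- The superdiagonal block `A_{i,i+1} = [Â_{i,i+1}; 0] ∈ ℂ^{t_i × t_{i+1}}`. -/
def ApadB (t : ℕ → ℕ) (Ahat : ∀ i : ℕ, Matrix (Fin (t (i+1))) (Fin (t (i+1))) ℂ) (i : ℕ) :
    Matrix (Fin (t i)) (Fin (t (i+1))) ℂ :=
  Matrix.of fun a b => if h : (a : ℕ) < t (i+1) then Ahat i ⟨(a : ℕ), h⟩ b else 0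

/-- The constant term `A₀` of the block bidiagonal pencil `A₀ + λE₀` (only superdiagonal
blocks `A_{i,i+1}`). -/
def jordA (k : ℕ) (t : ℕ → ℕ)
    (Ahat : ∀ i : ℕ, Matrix (Fin (t (i+1))) (Fin (t (i+1))) ℂ) :
    Matrix (Σ i : Fin k, Fin (t (i : ℕ))) (Σ j : Fin k, Fin (t (j : ℕ))) ℂ :=
  Matrix.of fun p q =>
    if h : (q.1 : ℕ) = (p.1 : ℕ) + 1 then
      ApadB t Ahat (p.1 : ℕ) p.2 (Fin.cast (congrArg t h) q.2)
    else 0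

/-- The coefficient `E₀` of `λ` in the block bidiagonal pencil `A₀ + λE₀` (only diagonal
blocks `E_{i,i}`). -/
def jordE (k : ℕ) (t : ℕ → ℕ) (E : ∀ i : ℕ, Matrix (Fin (t i)) (Fin (t i)) ℂ) :
    Matrix (Σ i : Fin k, Fin (t (i : ℕ))) (Σ j : Fin k, Fin (t (j : ℕ))) ℂ :=
  Matrix.of fun p q =>
    if h : (q.1 : ℕ) = (p.1 : ℕ) then E (p.1 : ℕ) p.2 (Fin.cast (congrArg t h) q.2) else 0

/-- `Ẑ_i = −E_{i,i}⁻¹ A_{i,i+1} ∈ ℂ^{t_i × t_{i+1}}`. -/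
def Zhat13 (t : ℕ → ℕ) (E : ∀ i : ℕ, Matrix (Fin (t i)) (Fin (t i)) ℂ)
    (Ahat : ∀ i : ℕ, Matrix (Fin (t (i+1))) (Fin (t (i+1))) ℂ) (i : ℕ) :
    Matrix (Fin (t i)) (Fin (t (i+1))) ℂ :=
  -((E i)⁻¹ * ApadB t Ahat i)

/-- The product `Ẑ_{j:j+d-1} = Ẑ_j Ẑ_{j+1} ⋯ Ẑ_{j+d-1}` (equal to `I` for `d = 0`). -/
def Zp13 (t : ℕ → ℕ) (E : ∀ i : ℕ, Matrix (Fin (t i)) (Fin (t i)) ℂ)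
    (Ahat : ∀ i : ℕ, Matrix (Fin (t (i+1))) (Fin (t (i+1))) ℂ) (j : ℕ) :
    (d : ℕ) → Matrix (Fin (t j)) (Fin (t (j + d))) ℂ
  | 0 => Matrix.of fun a b => if (a : ℕ) = (b : ℕ) then 1 else 0
  | d + 1 => Zp13 t E Ahat j d * Zhat13 t E Ahat (j + d)

/-- The block vector `Q_i(λ)` of candidate root polynomials of order `i+1`: its `j`-th block
row is `λ^j Ẑ_{j:i-1} I_{t_i, t_{i+1}+1 : t_i}` for `j ≤ i` and `0` for `j > i` (`0`-based
`i`, `j`). -/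
def Q13 (k : ℕ) (t : ℕ → ℕ) (E : ∀ i : ℕ, Matrix (Fin (t i)) (Fin (t i)) ℂ)
    (Ahat : ∀ i : ℕ, Matrix (Fin (t (i+1))) (Fin (t (i+1))) ℂ) (i : ℕ) :
    Matrix (Σ j : Fin k, Fin (t (j : ℕ))) (Fin (t i - t (i+1))) (Polynomial ℂ) :=
  Matrix.of fun p c =>
    if h : (p.1 : ℕ) ≤ i then
      Polynomial.X ^ (p.1 : ℕ) *
        Polynomial.C (Zp13 t E Ahat (p.1 : ℕ) (i - (p.1 : ℕ)) p.2
          (Fin.cast (congrArg t (by omega : i = (p.1 : ℕ) + (i - (p.1 : ℕ))))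
            ⟨t (i+1) + (c : ℕ), by have hc := c.isLt; omega⟩))
    else 0

/-- `M` is upper triangular (possibly rectangular) with nonzero diagonal entries. -/
def IsUpperTri {m n : ℕ} (M : Matrix (Fin m) (Fin n) ℂ) : Prop :=
  (∀ (a : Fin m) (b : Fin n), (b : ℕ) < (a : ℕ) → M a b = 0) ∧
    ∀ (a : Fin m) (b : Fin n), (a : ℕ) = (b : ℕ) → M a b ≠ 0

theorem IsUpperTri.mul {m p n : ℕ} {M : Matrix (Fin m) (Fin p) ℂ} {N : Matrix (Fin p) (Fin n) ℂ}
    (hM : IsUpperTri M) (hN : IsUpperTri N) (hnp : n ≤ p) : IsUpperTri (M * N) := by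
  refine ⟨fun a b hab => ?_, fun a b hab => ?_⟩
  · rw [Matrix.mul_apply]
    refine Finset.sum_eq_zero fun c _ => ?_
    rcases lt_or_ge (c : ℕ) (a : ℕ) with h | h
    · rw [hM.1 a c h, zero_mul]
    · rw [hN.1 c b (by omega), mul_zero]
  · rw [Matrix.mul_apply, Finset.sum_eq_single (⟨b, b.isLt.trans_le hnp⟩ : Fin p)]
    · exact mul_ne_zero (hM.2 _ _ hab) (hN.2 _ _ rfl)
    · intro c _ hc
      have hc' : (c : ℕ) ≠ b := fun h => hc (Fin.ext h)
      rcases lt_or_ge (c : ℕ) (a : ℕ) with h | h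
      · rw [hM.1 a c h, zero_mul]
      · rw [hN.1 c b (by omega), mul_zero]
    · simp

theorem IsUpperTri.det_ne_zero {n : ℕ} {M : Matrix (Fin n) (Fin n) ℂ} (hM : IsUpperTri M) :
    M.det ≠ 0 := by
  rw [Matrix.det_of_isUpperTriangular (fun a b h => hM.1 a b h)]
  exact Finset.prod_ne_zero_iff.2 fun a _ => hM.2 a a rfl

theorem IsUpperTri.inv {n : ℕ} {M : Matrix (Fin n) (Fin n) ℂ} (hM : IsUpperTri M) :
    IsUpperTri M⁻¹ := by
  have hdet : IsUnit M.det := isUnit_iff_ne_zero.2 hM.det_ne_zero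
  let _ := M.invertibleOfIsUnitDet hdet
  have htri : M⁻¹.IsUpperTriangular :=
    Matrix.blockTriangular_inv_of_blockTriangular (fun a b h => hM.1 a b h)
  refine ⟨fun a b hab => htri hab, fun a b hab h => ?_⟩
  obtain rfl : a = b := Fin.ext hab
  have h1 : (M⁻¹ * M) a a = 1 := by rw [Matrix.nonsing_inv_mul M hdet, Matrix.one_apply_eq]
  rw [Matrix.mul_apply, Finset.sum_eq_zero] at h1
  · exact zero_ne_one h1
  · intro c _
    rcases lt_trichotomy c a with hc | rfl | hc
    · rw [htri hc, zero_mul]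
    · rw [h, zero_mul]
    · rw [hM.1 c a hc, mul_zero]

theorem IsUpperTri.neg {m n : ℕ} {M : Matrix (Fin m) (Fin n) ℂ} (hM : IsUpperTri M) :
    IsUpperTri (-M) :=
  ⟨fun a b h => by rw [Matrix.neg_apply, hM.1 a b h, neg_zero],
    fun a b h => neg_ne_zero.2 (hM.2 a b h)⟩

theorem IsUpperTri.eq_zero_of_mulVec {m n : ℕ} {M : Matrix (Fin m) (Fin n) ℂ}
    (hM : IsUpperTri M) (hnm : n ≤ m) {v : Fin n → ℂ} (hv : M *ᵥ v = 0) : v = 0 := by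
  have hsub : IsUpperTri (M.submatrix (Fin.castLE hnm) id) :=
    ⟨fun a b h => hM.1 _ _ h, fun a b h => hM.2 _ _ h⟩
  exact Matrix.eq_zero_of_mulVec_eq_zero hsub.det_ne_zero
    (funext fun a => congrFun hv (Fin.castLE hnm a))

/-- The vectors `x(0)` for polynomial vectors `x` with `X ^ m ∣ P x`. -/
def zeroSpace {ι κ : Type*} [Fintype κ] (P : Matrix ι κ ℂ[X]) (m : ℕ) : Submodule ℂ (κ → ℂ) where
  carrier := {v | ∃ x : κ → ℂ[X], (∀ i, X ^ m ∣ (P *ᵥ x) i) ∧ ∀ j, v j = (x j).eval 0}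
  add_mem' := by
    rintro v w ⟨x, hx, hv⟩ ⟨y, hy, hw⟩
    refine ⟨x + y, fun i => ?_, fun j => by simp [hv, hw]⟩
    rw [Matrix.mulVec_add]
    exact dvd_add (hx i) (hy i)
  zero_mem' := ⟨0, fun i => by simp, fun j => by simp⟩
  smul_mem' := by
    rintro c v ⟨x, hx, hv⟩
    refine ⟨(C c : ℂ[X]) • x, fun i => ?_, fun j => by simp [hv]⟩
    rw [Matrix.mulVec_smul]
    exact Dvd.dvd.mul_left (hx i) _

theorem mem_zeroSpace {ι κ : Type*} [Fintype κ] {P : Matrix ι κ ℂ[X]} {m : ℕ} {v : κ → ℂ} :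
    v ∈ zeroSpace P m ↔
      ∃ x : κ → ℂ[X], (∀ i, X ^ m ∣ (P *ᵥ x) i) ∧ ∀ j, v j = (x j).eval 0 := Iff.rfl

/-- The vectors supported on `S`. -/
def coordSubspace {κ : Type*} (S : Finset κ) : Submodule ℂ (κ → ℂ) where
  carrier := {v | ∀ j ∉ S, v j = 0}
  add_mem' hv hw j hj := by simp [hv j hj, hw j hj]
  zero_mem' j _ := rfl
  smul_mem' c v hv j hj := by simp [hv j hj]

theorem mem_coordSubspace {κ : Type*} {S : Finset κ} {v : κ → ℂ} :
    v ∈ coordSubspace S ↔ ∀ j ∉ S, v j = 0 := Iff.rfl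

theorem finrank_coordSubspace {κ : Type*} [Fintype κ] [DecidableEq κ] (S : Finset κ) :
    Module.finrank ℂ (coordSubspace S) = S.card := by
  have h : coordSubspace S = ⨅ j ∈ ((Sᶜ : Finset κ) : Set κ),
      LinearMap.ker (LinearMap.proj j : (κ → ℂ) →ₗ[ℂ] ℂ) := by
    ext v
    simp [mem_coordSubspace]
  rw [h, (LinearMap.iInfKerProjEquiv ℂ (fun _ : κ => ℂ) (I := (S : Set κ))
    (J := ((Sᶜ : Finset κ) : Set κ)) (by simp [disjoint_compl_right]) (by simp)).finrank_eq]
  simp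

theorem evalMat_mulVec {ι κ : Type*} [Fintype κ] (P : Matrix ι κ ℂ[X]) (x : κ → ℂ[X]) (z : ℂ)
    (i : ι) : ((P *ᵥ x) i).eval z = (evalMat P z *ᵥ fun j => (x j).eval z) i := by
  simp [Matrix.mulVec, dotProduct, evalMat, Polynomial.eval_finsetSum]

theorem evalMat_det {ι : Type*} [Fintype ι] [DecidableEq ι] (P : Matrix ι ι ℂ[X]) (z : ℂ) :
    (evalMat P z).det = P.det.eval z :=
  ((Polynomial.evalRingHom z).map_det P).symm

theorem dvd_mulVec {ι κ R : Type*} [Fintype κ] [CommSemiring R] (M : Matrix ι κ R) {y : κ → R}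
    {q : R} (h : ∀ j, q ∣ y j) (i : ι) : q ∣ (M *ᵥ y) i :=
  Finset.dvd_sum fun j _ => Dvd.dvd.mul_left (h j) _

theorem isCoprime_X_pow {p : ℂ[X]} (hp : p.eval 0 ≠ 0) (m : ℕ) : IsCoprime (X ^ m) p := by
  refine IsCoprime.pow_left ((Irreducible.coprime_iff_not_dvd Polynomial.irreducible_X).2 ?_)
  rwa [Polynomial.X_dvd_iff, Polynomial.coeff_zero_eq_eval_zero]

/-- Equivalence at `0` preserves the dimension of the zero spaces. -/
theorem finrank_zeroSpace_mul_mul {ι κ : Type*} [Fintype ι] [Fintype κ] [DecidableEq ι]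
    [DecidableEq κ] (P : Matrix ι κ ℂ[X]) {M : Matrix ι ι ℂ[X]} {N : Matrix κ κ ℂ[X]}
    (hM : (evalMat M 0).det ≠ 0) (hN : (evalMat N 0).det ≠ 0) (m : ℕ) :
    Module.finrank ℂ (zeroSpace (M * P * N) m) = Module.finrank ℂ (zeroSpace P m) := by
  have hinj : Function.Injective (evalMat N 0).mulVecLin :=
    Matrix.mulVec_injective_of_isUnit
      ((Matrix.isUnit_iff_isUnit_det _).2 (isUnit_iff_ne_zero.2 hN))
  rw [(Submodule.equivMapOfInjective _ hinj (zeroSpace (M * P * N) m)).finrank_eq]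
  suffices hmap : (zeroSpace (M * P * N) m).map (evalMat N 0).mulVecLin = zeroSpace P m by
    rw [hmap]
  rw [evalMat_det] at hM
  have hN' := hN
  rw [evalMat_det] at hN'
  ext v
  rw [Submodule.mem_map]
  constructor
  · rintro ⟨w, ⟨y, hy, hw⟩, rfl⟩
    refine ⟨N *ᵥ y, fun i => ?_, fun j => ?_⟩
    · refine (isCoprime_X_pow hM m).dvd_of_dvd_mul_left ?_
      have h := dvd_mulVec M.adjugate hy i
      rwa [Matrix.mulVec_mulVec, ← Matrix.mul_assoc, ← Matrix.mul_assoc, Matrix.adjugate_mul,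
        ← Matrix.mulVec_mulVec, Matrix.smul_mul, Matrix.one_mul, Matrix.smul_mulVec] at h
    · rw [evalMat_mulVec, Matrix.mulVecLin_apply]
      rw [funext hw]
  · rintro ⟨x, hx, hv⟩
    refine ⟨(N.det.eval 0)⁻¹ • fun j => ((N.adjugate *ᵥ x) j).eval 0,
      Submodule.smul_mem _ _ ⟨N.adjugate *ᵥ x, fun i => ?_, fun j => rfl⟩, ?_⟩
    · rw [Matrix.mulVec_mulVec, Matrix.mul_assoc, Matrix.mul_adjugate, Matrix.mul_smul,
        Matrix.mul_one, Matrix.smul_mulVec, ← Matrix.mulVec_mulVec]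
      exact Dvd.dvd.mul_left (dvd_mulVec M hx i) _
    · rw [map_smul]
      ext j
      rw [Pi.smul_apply, Matrix.mulVecLin_apply, ← evalMat_mulVec, Matrix.mulVec_mulVec,
        Matrix.mul_adjugate, Matrix.smul_mulVec, Matrix.one_mulVec, Pi.smul_apply, smul_eq_mul,
        smul_eq_mul, Polynomial.eval_mul, hv, inv_mul_cancel_left₀ hN']

/-- For a regular polynomial matrix, the number of partial multiplicities that are at least `m`
is the dimension of the `m`-th zero space. -/
theorem HasPartialMultiplicities.card_le_eq_finrank {ι : Type*} [Fintype ι] [DecidableEq ι]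
    {P : Matrix ι ι ℂ[X]} (hP : P.det ≠ 0) {r : ℕ} {σ : Fin r → ℕ}
    (h : HasPartialMultiplicities P 0 σ) (m : ℕ) :
    (Finset.univ.filter fun a : Fin r => m ≤ σ a).card = Module.finrank ℂ (zeroSpace P m) := by
  obtain ⟨-, M, N, fR, fC, hR, hC, hM, hN, hD⟩ := h
  rw [← finrank_zeroSpace_mul_mul P hM hN m]
  have hdet : (M * P * N).det ≠ 0 := by
    rw [Matrix.det_mul, Matrix.det_mul]
    refine mul_ne_zero (mul_ne_zero ?_ hP) ?_
    · rintro h0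
      rw [evalMat_det, h0] at hM
      simp at hM
    · rintro h0
      rw [evalMat_det, h0] at hN
      simp at hN
  have hRs : Function.Surjective fR := by
    intro i
    by_contra! hi
    refine hdet (Matrix.det_eq_zero_of_row_eq_zero i fun j => ?_)
    rw [hD, Matrix.of_apply]
    exact Finset.sum_eq_zero fun a _ => if_neg fun h => hi a h.1.symm
  have hCs : Function.Surjective fC :=
    ((Fintype.bijective_iff_injective_and_card fC).2
      ⟨hC, Fintype.card_of_bijective ⟨hR, hRs⟩⟩).2
  have hmul : ∀ (y : ι → ℂ[X]) (a : Fin r), ((M * P * N) *ᵥ y) (fR a) = X ^ σ a * y (fC a) := by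
    intro y a
    rw [hD, Matrix.mulVec, dotProduct, Finset.sum_eq_single (fC a)]
    · simp only [Matrix.of_apply, map_zero, sub_zero]
      rw [Finset.sum_eq_single a]
      · simp
      · intro b _ hb
        exact if_neg fun h => hb (hR h.1.symm)
      · simp
    · intro j _ hj
      rw [Matrix.of_apply, Finset.sum_eq_zero, zero_mul]
      intro b _
      refine if_neg fun h => hj ?_
      rw [h.2, hR h.1]
    · simp
  have hW : zeroSpace (M * P * N) m
      = coordSubspace ((Finset.univ.filter fun a : Fin r => m ≤ σ a).image fC) := by
    ext v
    rw [mem_zeroSpace, mem_coordSubspace]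
    constructor
    · rintro ⟨x, hx, hv⟩ j hj
      obtain ⟨a, rfl⟩ := hCs j
      have ha : σ a < m := by
        by_contra! hle
        exact hj (Finset.mem_image_of_mem _ (by simpa using hle))
      have h1 := hx (fR a)
      rw [hmul, ← Nat.add_sub_cancel' ha.le, pow_add] at h1
      have h2 : X ∣ x (fC a) :=
        (dvd_pow_self X (by omega)).trans
          ((mul_dvd_mul_iff_left (pow_ne_zero _ Polynomial.X_ne_zero)).1 h1)
      rw [hv, ← Polynomial.coeff_zero_eq_eval_zero]
      exact Polynomial.X_dvd_iff.1 h2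
    · intro hv
      refine ⟨fun j => C (v j), fun i => ?_, fun j => by simp⟩
      obtain ⟨a, rfl⟩ := hRs i
      rw [hmul]
      by_cases ha : m ≤ σ a
      · exact Dvd.dvd.mul_right (pow_dvd_pow _ ha) _
      · rw [hv (fC a)]
        · simp
        · rintro hj
          obtain ⟨b, hb, hba⟩ := Finset.mem_image.1 hj
          rw [hC hba] at hb
          exact ha (Finset.mem_filter.1 hb).2
  rw [hW, finrank_coordSubspace, Finset.card_image_of_injective _ hC]

/-- The right nullspace of a regular polynomial matrix has no nonempty basis. -/
theorem IsMinimalBasis.eq_zero_of_det_ne_zero {ι : Type*} [Fintype ι] [DecidableEq ι]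
    {P : Matrix ι ι ℂ[X]} (hP : P.det ≠ 0) {p : ℕ} {N : Matrix ι (Fin p) ℂ[X]}
    (hN : IsMinimalBasis P N) : p = 0 := by
  by_contra hp
  have hdet : (toRat P).det ≠ 0 := by
    have : (toRat P).det = algebraMap ℂ[X] (RatFunc ℂ) P.det :=
      ((algebraMap ℂ[X] (RatFunc ℂ)).map_det P).symm
    rw [this]
    simpa using hP
  let a : Fin p := ⟨0, Nat.pos_of_ne_zero hp⟩
  have hmem : (fun i => toRat N i a) ∈ rightNullspace P := by
    rw [← hN.2.1]
    exact Submodule.subset_span ⟨a, rfl⟩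
  exact hN.1.ne_zero a (Matrix.eq_zero_of_mulVec_eq_zero hdet (LinearMap.mem_ker.1 hmem))

theorem isMinimalBasis_of_det_ne_zero {ι : Type*} [Fintype ι] [DecidableEq ι]
    {P : Matrix ι ι ℂ[X]} (hP : P.det ≠ 0) (N : Matrix ι (Fin 0) ℂ[X]) : IsMinimalBasis P N := by
  have hdet : (toRat P).det ≠ 0 := by
    have : (toRat P).det = algebraMap ℂ[X] (RatFunc ℂ) P.det :=
      ((algebraMap ℂ[X] (RatFunc ℂ)).map_det P).symm
    rw [this]
    simpa using hP
  refine ⟨linearIndependent_empty_type, ?_, fun M _ _ => by simp⟩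
  rw [Set.range_eq_empty, Submodule.span_empty, eq_comm, eq_bot_iff]
  intro v hv
  exact Matrix.eq_zero_of_mulVec_eq_zero hdet (LinearMap.mem_ker.1 hv)

/-- For a regular polynomial matrix, the rank conditions relative to minimal bases are plain rank
conditions. -/
theorem forall_isMinimalBasis_rank_iff {ι : Type*} [Fintype ι] [DecidableEq ι]
    {P : Matrix ι ι ℂ[X]} (hP : P.det ≠ 0) {s : ℕ} (w : Fin s → ι → ℂ) :
    (∀ (p : ℕ) (N : Matrix ι (Fin p) ℂ[X]), IsMinimalBasis P N →
      (Matrix.of fun (i : ι) (j : Sum (Fin p) (Fin s)) =>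
        Sum.elim (fun a => (N i a).eval 0) (fun b => w b i) j).rank = p + s) ↔
    (Matrix.of fun i b => w b i).rank = s := by
  have key : ∀ N : Matrix ι (Fin 0) ℂ[X],
      (Matrix.of fun (i : ι) (j : Sum (Fin 0) (Fin s)) =>
        Sum.elim (fun a => (N i a).eval 0) (fun b => w b i) j).rank
      = (Matrix.of fun i b => w b i).rank := by
    intro N
    rw [← Matrix.rank_submatrix (Matrix.of fun i b => w b i) (Equiv.refl ι)
      (Equiv.emptySum (Fin 0) (Fin s))]
    congr 1
    ext i j
    rcases j with j | j
    · exact j.elim0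
    · simp
  constructor
  · intro h
    rw [← key 0, h 0 0 (isMinimalBasis_of_det_ne_zero hP 0), zero_add]
  · intro h p N hN
    obtain rfl := hN.eq_zero_of_det_ne_zero hP
    rw [key, h, zero_add]

theorem isRootPoly_iff_of_det_ne_zero {ι : Type*} [Fintype ι] [DecidableEq ι]
    {P : Matrix ι ι ℂ[X]} (hP : P.det ≠ 0) (k : ℕ) (x : ι → ℂ[X]) :
    IsRootPoly P 0 k x ↔ IsZeroDirection P 0 k x := by
  refine ⟨And.left, fun h => ⟨h, ?_⟩⟩
  have hli : LinearIndependent ℂ fun (_ : Fin 1) i => (x i).eval 0 :=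
    linearIndependent_unique_iff.2 h.2.1
  refine (forall_isMinimalBasis_rank_iff hP (s := 1) fun _ i => (x i).eval 0).2 ?_
  rw [← Matrix.rank_transpose]
  exact hli.rank_matrix.trans (Fintype.card_fin 1)

theorem isUpperTri_Zhat13 {t : ℕ → ℕ} (ht : Antitone t)
    {E : ∀ i : ℕ, Matrix (Fin (t i)) (Fin (t i)) ℂ}
    {Ahat : ∀ i : ℕ, Matrix (Fin (t (i+1))) (Fin (t (i+1))) ℂ}
    (hE : ∀ i, IsUpperTri (E i)) (hA : ∀ i, IsUpperTri (Ahat i)) (i : ℕ) :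
    IsUpperTri (Zhat13 t E Ahat i) := by
  refine ((hE i).inv.mul (N := ApadB t Ahat i) ⟨fun a b h => ?_, fun a b h => ?_⟩
    (ht i.le_succ)).neg
  · rw [ApadB, Matrix.of_apply]
    split_ifs with ha
    · exact (hA i).1 _ _ h
    · rfl
  · rw [ApadB, Matrix.of_apply, dif_pos (h ▸ b.isLt)]
    exact (hA i).2 _ _ h

theorem isUpperTri_Zp13 {t : ℕ → ℕ} (ht : Antitone t)
    {E : ∀ i : ℕ, Matrix (Fin (t i)) (Fin (t i)) ℂ}
    {Ahat : ∀ i : ℕ, Matrix (Fin (t (i+1))) (Fin (t (i+1))) ℂ}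
    (hE : ∀ i, IsUpperTri (E i)) (hA : ∀ i, IsUpperTri (Ahat i)) (j d : ℕ) :
    IsUpperTri (Zp13 t E Ahat j d) := by
  induction d with
  | zero =>
    exact ⟨fun a b h => if_neg h.ne', fun a b h => by simp [Zp13, h]⟩
  | succ d ih => exact ih.mul (isUpperTri_Zhat13 ht hE hA (j + d)) (ht (Nat.le_succ _))

/-- The product `Ẑ_j ⋯ Ẑ_{i-1}` with its column index typed by `i` itself. -/
def zprod (t : ℕ → ℕ) (E : ∀ i : ℕ, Matrix (Fin (t i)) (Fin (t i)) ℂ)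
    (Ahat : ∀ i : ℕ, Matrix (Fin (t (i+1))) (Fin (t (i+1))) ℂ) (j d i : ℕ) (h : i = j + d) :
    Matrix (Fin (t j)) (Fin (t i)) ℂ :=
  (Zp13 t E Ahat j d).submatrix id (Fin.cast (congrArg t h))

theorem zprod_zero (t : ℕ → ℕ) (E : ∀ i : ℕ, Matrix (Fin (t i)) (Fin (t i)) ℂ)
    (Ahat : ∀ i : ℕ, Matrix (Fin (t (i+1))) (Fin (t (i+1))) ℂ) (j : ℕ) :
    zprod t E Ahat j 0 j rfl = 1 := by
  ext a b
  simp [zprod, Zp13, Matrix.one_apply, Fin.ext_iff]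

theorem zprod_succ_right (t : ℕ → ℕ) (E : ∀ i : ℕ, Matrix (Fin (t i)) (Fin (t i)) ℂ)
    (Ahat : ∀ i : ℕ, Matrix (Fin (t (i+1))) (Fin (t (i+1))) ℂ) (j d i : ℕ) (h : i = j + d) :
    zprod t E Ahat j (d + 1) (i + 1) (by omega)
      = zprod t E Ahat j d i h * Zhat13 t E Ahat i := by
  subst h
  rfl

theorem zprod_succ_left (t : ℕ → ℕ) (E : ∀ i : ℕ, Matrix (Fin (t i)) (Fin (t i)) ℂ)
    (Ahat : ∀ i : ℕ, Matrix (Fin (t (i+1))) (Fin (t (i+1))) ℂ) (j d i : ℕ) (h : i = j + 1 + d) :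
    zprod t E Ahat j (d + 1) i (by omega)
      = Zhat13 t E Ahat j * zprod t E Ahat (j + 1) d i h := by
  induction d generalizing i with
  | zero =>
    obtain rfl : i = j + 1 := h
    rw [zprod_zero, zprod_succ_right t E Ahat j 0 j rfl, zprod_zero, Matrix.one_mul,
      Matrix.mul_one]
  | succ d ih =>
    obtain ⟨i, rfl⟩ : ∃ i', i = i' + 1 := ⟨j + 1 + d, h⟩
    rw [zprod_succ_right t E Ahat j (d + 1) i (by omega), ih i (by omega),
      zprod_succ_right t E Ahat (j + 1) d i (by omega), Matrix.mul_assoc]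

/-- The `l`-th block of a block vector, extended by zero for `l ≥ k`. -/
def vecBlock {k : ℕ} {t : ℕ → ℕ} (x : (Σ i : Fin k, Fin (t (i : ℕ))) → ℂ[X]) (l : ℕ) :
    Fin (t l) → ℂ[X] :=
  fun b => if h : l < k then x ⟨⟨l, h⟩, b⟩ else 0

theorem vecBlock_val {k : ℕ} {t : ℕ → ℕ} (x : (Σ i : Fin k, Fin (t (i : ℕ))) → ℂ[X])
    (l : Fin k) (b : Fin (t (l : ℕ))) : vecBlock x (l : ℕ) b = x ⟨l, b⟩ :=
  dif_pos l.isLt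

theorem sum_dite_block {k : ℕ} {t : ℕ → ℕ} (x : (Σ i : Fin k, Fin (t (i : ℕ))) → ℂ[X]) (l : ℕ)
    (f : Fin (t l) → ℂ) :
    ∑ q : (Σ i : Fin k, Fin (t (i : ℕ))),
      C (if h : (q.1 : ℕ) = l then f (Fin.cast (congrArg t h) q.2) else 0) * x q
      = ∑ b, C (f b) * vecBlock x l b := by
  rw [Fintype.sum_sigma]
  by_cases hl : l < k
  · rw [Finset.sum_eq_single (⟨l, hl⟩ : Fin k)]
    · simp [vecBlock, hl]
    · intro i _ hi
      have hi' : (i : ℕ) ≠ l := fun h => hi (Fin.ext h)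
      simp [hi']
    · simp
  · rw [Finset.sum_eq_zero, eq_comm, Finset.sum_eq_zero]
    · intro b _
      simp [vecBlock, hl]
    · intro i _
      have hi' : (i : ℕ) ≠ l := by omega
      simp [hi']

/-- The action of the bidiagonal pencil on a block vector, in terms of `Ẑ`. -/
theorem pencil_mulVec_block {k : ℕ} {t : ℕ → ℕ}
    {E : ∀ i : ℕ, Matrix (Fin (t i)) (Fin (t i)) ℂ}
    {Ahat : ∀ i : ℕ, Matrix (Fin (t (i+1))) (Fin (t (i+1))) ℂ}
    (hE : ∀ i, IsUpperTri (E i)) (x : (Σ i : Fin k, Fin (t (i : ℕ))) → ℂ[X]) (l : Fin k) :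
    (fun a => (pencilMat (jordA k t Ahat) (jordE k t E) *ᵥ x) ⟨l, a⟩)
      = (E l).map C *ᵥ ((X : ℂ[X]) • vecBlock x l
          - (Zhat13 t E Ahat l).map C *ᵥ vecBlock x (l + 1)) := by
  have hEZ : E l * Zhat13 t E Ahat l = - ApadB t Ahat l := by
    rw [Zhat13, Matrix.mul_neg, ← Matrix.mul_assoc,
      Matrix.mul_nonsing_inv _ (isUnit_iff_ne_zero.2 (hE l).det_ne_zero), Matrix.one_mul]
  have hEZ' : (E l).map C * (Zhat13 t E Ahat l).map C = - (ApadB t Ahat l).map (C : ℂ → ℂ[X]) := by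
    rw [← Matrix.map_mul, hEZ]
    ext a b
    simp
  rw [Matrix.mulVec_sub, Matrix.mulVec_mulVec, hEZ', Matrix.mulVec_smul, Matrix.neg_mulVec,
    sub_neg_eq_add]
  ext1 a
  have h1 := sum_dite_block x (l : ℕ) (fun b => E l a b)
  have h2 := sum_dite_block x ((l : ℕ) + 1) (fun b => ApadB t Ahat l a b)
  simp only [Pi.add_apply, Pi.smul_apply, smul_eq_mul, Matrix.mulVec, dotProduct,
    Matrix.map_apply]
  rw [← h1, ← h2, Finset.mul_sum, ← Finset.sum_add_distrib]
  refine Finset.sum_congr rfl fun q _ => ?_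
  simp only [pencilMat, jordA, jordE, Matrix.of_apply]
  ring

theorem pencil_apply_of_lt {k : ℕ} {t : ℕ → ℕ}
    (E : ∀ i : ℕ, Matrix (Fin (t i)) (Fin (t i)) ℂ)
    (Ahat : ∀ i : ℕ, Matrix (Fin (t (i+1))) (Fin (t (i+1))) ℂ)
    (hE : ∀ i, IsUpperTri (E i)) (p q : Σ i : Fin k, Fin (t (i : ℕ)))
    (h : (q.1 : ℕ) < p.1 ∨ (q.1 : ℕ) = p.1 ∧ (q.2 : ℕ) < p.2) :
    pencilMat (jordA k t Ahat) (jordE k t E) p q = 0 := by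
  have h1 : (q.1 : ℕ) ≠ p.1 + 1 := by omega
  simp only [pencilMat, jordA, jordE, Matrix.of_apply, dif_neg h1]
  by_cases h2 : (q.1 : ℕ) = p.1
  · rw [dif_pos h2, (hE p.1).1 _ _ (by simp; omega)]
    simp
  · rw [dif_neg h2]
    simp

theorem pencil_det {k : ℕ} {t : ℕ → ℕ}
    {E : ∀ i : ℕ, Matrix (Fin (t i)) (Fin (t i)) ℂ}
    (Ahat : ∀ i : ℕ, Matrix (Fin (t (i+1))) (Fin (t (i+1))) ℂ)
    (hE : ∀ i, IsUpperTri (E i)) :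
    (pencilMat (jordA k t Ahat) (jordE k t E)).det
      = C (∏ p : (Σ i : Fin k, Fin (t (i : ℕ))), E p.1 p.2 p.2)
        * X ^ Fintype.card (Σ i : Fin k, Fin (t (i : ℕ))) := by
  let _ : LinearOrder (Σ i : Fin k, Fin (t (i : ℕ))) :=
    inferInstanceAs (LinearOrder (Σₗ i : Fin k, Fin (t (i : ℕ))))
  have hdet := Matrix.det_of_isUpperTriangular
      (M := pencilMat (jordA k t Ahat) (jordE k t E)) fun p q hpq => by
    refine pencil_apply_of_lt E Ahat hE p q ?_
    have hpq' : Sigma.Lex (· < ·) (fun _ => (· < ·)) q p := hpq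
    cases hpq' with
    | left _ _ h => exact Or.inl h
    | right _ _ h => exact Or.inr ⟨rfl, h⟩
  rw [hdet, map_prod, ← Finset.card_univ, ← Finset.prod_const,
    ← Finset.prod_mul_distrib]
  refine Finset.prod_congr rfl fun p _ => ?_
  simp [pencilMat, jordA, jordE]

theorem pencil_det_ne_zero {k : ℕ} {t : ℕ → ℕ}
    {E : ∀ i : ℕ, Matrix (Fin (t i)) (Fin (t i)) ℂ}
    (Ahat : ∀ i : ℕ, Matrix (Fin (t (i+1))) (Fin (t (i+1))) ℂ)
    (hE : ∀ i, IsUpperTri (E i)) :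
    (pencilMat (jordA k t Ahat) (jordE k t E)).det ≠ 0 := by
  rw [pencil_det Ahat hE]
  refine mul_ne_zero ?_ (pow_ne_zero _ Polynomial.X_ne_zero)
  rw [Ne, Polynomial.C_eq_zero, Finset.prod_eq_zero_iff]
  rintro ⟨p, -, h⟩
  exact (hE p.1).2 p.2 p.2 rfl h

/-- Consecutive blocks of a vector annihilated modulo `X ^ m` are linked through `Ẑ`. -/
theorem dvd_X_smul_sub_of_dvd_pencil {k : ℕ} {t : ℕ → ℕ} (htz : ∀ j, k ≤ j → t j = 0)
    {E : ∀ i : ℕ, Matrix (Fin (t i)) (Fin (t i)) ℂ}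
    {Ahat : ∀ i : ℕ, Matrix (Fin (t (i+1))) (Fin (t (i+1))) ℂ}
    (hE : ∀ i, IsUpperTri (E i)) {q : ℂ[X]}
    {x : (Σ i : Fin k, Fin (t (i : ℕ))) → ℂ[X]}
    (hx : ∀ p, q ∣ (pencilMat (jordA k t Ahat) (jordE k t E) *ᵥ x) p) (l : ℕ) (a : Fin (t l)) :
    q ∣ ((X : ℂ[X]) • vecBlock x l - (Zhat13 t E Ahat l).map C *ᵥ vecBlock x (l + 1)) a := by
  have hl : l < k := by
    by_contra! h
    have := a.isLt
    have := htz l h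
    omega
  have h := dvd_mulVec ((E l)⁻¹.map C) (fun b => hx ⟨⟨l, hl⟩, b⟩) a
  rw [pencil_mulVec_block hE x ⟨l, hl⟩, Matrix.mulVec_mulVec, ← Matrix.map_mul,
    Matrix.nonsing_inv_mul _ (isUnit_iff_ne_zero.2 (hE l).det_ne_zero),
    Matrix.map_one _ C_0 C_1, Matrix.one_mulVec] at h
  exact h

theorem dvd_X_pow_smul_sub_of_dvd_pencil {k : ℕ} {t : ℕ → ℕ} (htz : ∀ j, k ≤ j → t j = 0)
    {E : ∀ i : ℕ, Matrix (Fin (t i)) (Fin (t i)) ℂ}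
    {Ahat : ∀ i : ℕ, Matrix (Fin (t (i+1))) (Fin (t (i+1))) ℂ}
    (hE : ∀ i, IsUpperTri (E i)) {q : ℂ[X]}
    {x : (Σ i : Fin k, Fin (t (i : ℕ))) → ℂ[X]}
    (hx : ∀ p, q ∣ (pencilMat (jordA k t Ahat) (jordE k t E) *ᵥ x) p) (d : ℕ) (a : Fin (t 0)) :
    q ∣ ((X : ℂ[X]) ^ d • vecBlock x 0
      - (zprod t E Ahat 0 d d (zero_add d).symm).map C *ᵥ vecBlock x d) a := by
  induction d with
  | zero =>
    rw [zprod_zero, Matrix.map_one _ C_0 C_1, Matrix.one_mulVec]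
    simp
  | succ d ih =>
    have h1 := dvd_mulVec ((zprod t E Ahat 0 d d (zero_add d).symm).map C)
      (dvd_X_smul_sub_of_dvd_pencil htz hE hx d) a
    have h2 := dvd_add (Dvd.dvd.mul_left ih X) h1
    rw [zprod_succ_right t E Ahat 0 d d (zero_add d).symm, Matrix.map_mul,
      ← Matrix.mulVec_mulVec]
    refine h2.trans (dvd_of_eq ?_)
    rw [Matrix.mulVec_sub, Matrix.mulVec_smul]
    simp only [Pi.sub_apply, Pi.smul_apply, smul_eq_mul]
    ring

theorem coeff_map_C_mulVec {m n : ℕ} (M : Matrix (Fin m) (Fin n) ℂ) (y : Fin n → ℂ[X]) (d : ℕ)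
    (a : Fin m) : ((M.map C *ᵥ y) a).coeff d = (M *ᵥ fun b => (y b).coeff d) a := by
  simp [Matrix.mulVec, dotProduct, Polynomial.finsetSum_coeff]

/-- A vector annihilated modulo `X ^ (d + 1)` takes at `0` a value supported on the first
`t d` entries of the first block. -/
theorem eval_eq_zero_of_dvd_pencil {k : ℕ} {t : ℕ → ℕ} (htz : ∀ j, k ≤ j → t j = 0)
    (ht : Antitone t) {E : ∀ i : ℕ, Matrix (Fin (t i)) (Fin (t i)) ℂ}
    {Ahat : ∀ i : ℕ, Matrix (Fin (t (i+1))) (Fin (t (i+1))) ℂ}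
    (hE : ∀ i, IsUpperTri (E i)) (hA : ∀ i, IsUpperTri (Ahat i)) {d : ℕ}
    {x : (Σ i : Fin k, Fin (t (i : ℕ))) → ℂ[X]}
    (hx : ∀ p, X ^ (d + 1) ∣ (pencilMat (jordA k t Ahat) (jordE k t E) *ᵥ x) p)
    (p : Σ i : Fin k, Fin (t (i : ℕ))) (hp : ¬((p.1 : ℕ) = 0 ∧ (p.2 : ℕ) < t d)) :
    (x p).eval 0 = 0 := by
  obtain ⟨⟨l, hl⟩, b⟩ := p
  rw [← vecBlock_val x ⟨l, hl⟩ b, ← Polynomial.coeff_zero_eq_eval_zero]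
  rcases l with _ | l
  · have h := Polynomial.X_pow_dvd_iff.1
      (dvd_X_pow_smul_sub_of_dvd_pencil htz hE hx d b) d d.lt_succ_self
    rw [Pi.sub_apply, Polynomial.coeff_sub, Pi.smul_apply, smul_eq_mul, coeff_map_C_mulVec,
      sub_eq_zero] at h
    have h0 := Polynomial.coeff_X_pow_mul (vecBlock x 0 b) d 0
    rw [zero_add] at h0
    refine h0.symm.trans (h.trans ?_)
    have hb : t d ≤ (b : ℕ) := not_lt.1 fun h => hp ⟨rfl, h⟩
    rw [Matrix.mulVec, dotProduct]
    refine Finset.sum_eq_zero fun c _ => ?_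
    rw [zprod, Matrix.submatrix_apply, (isUpperTri_Zp13 ht hE hA 0 d).1 _ _ ?_, zero_mul]
    exact c.isLt.trans_le hb
  · have h : Zhat13 t E Ahat l *ᵥ (fun b => (vecBlock x (l + 1) b).coeff 0) = 0 := by
      ext a
      have h1 := Polynomial.X_pow_dvd_iff.1
        (dvd_X_smul_sub_of_dvd_pencil htz hE hx l a) 0 d.succ_pos
      rw [Pi.sub_apply, Polynomial.coeff_sub, Pi.smul_apply, smul_eq_mul, coeff_map_C_mulVec,
        Polynomial.coeff_X_mul_zero, zero_sub, neg_eq_zero] at h1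
      exact h1
    exact congrFun
      ((isUpperTri_Zhat13 ht hE hA l).eq_zero_of_mulVec (ht l.le_succ) h) b

/-- The entries of `Q_i`, through the column-typed products. -/
theorem Q13_apply {k : ℕ} {t : ℕ → ℕ}
    (E : ∀ i : ℕ, Matrix (Fin (t i)) (Fin (t i)) ℂ)
    (Ahat : ∀ i : ℕ, Matrix (Fin (t (i+1))) (Fin (t (i+1))) ℂ) {i : ℕ}
    (c : Fin (t i - t (i + 1))) (b : Fin (t i)) (hb : (b : ℕ) = t (i + 1) + c)
    (p : Σ j : Fin k, Fin (t (j : ℕ))) {d : ℕ} (hd : i = p.1 + d) :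
    Q13 k t E Ahat i p c = X ^ (p.1 : ℕ) * C (zprod t E Ahat p.1 d i hd p.2 b) := by
  obtain rfl : d = i - p.1 := by omega
  rw [Q13, Matrix.of_apply, dif_pos (by omega), zprod, Matrix.submatrix_apply]
  congr 4
  exact Fin.ext hb.symm

theorem vecBlock_Q13 {k : ℕ} {t : ℕ → ℕ}
    (E : ∀ i : ℕ, Matrix (Fin (t i)) (Fin (t i)) ℂ)
    (Ahat : ∀ i : ℕ, Matrix (Fin (t (i+1))) (Fin (t (i+1))) ℂ) {i : ℕ} (hi : i < k)
    (c : Fin (t i - t (i + 1))) (b : Fin (t i)) (hb : (b : ℕ) = t (i + 1) + c)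
    {l d : ℕ} (hd : i = l + d) :
    vecBlock (fun p => Q13 k t E Ahat i p c) l
      = (X : ℂ[X]) ^ l • fun a => C (zprod t E Ahat l d i hd a b) := by
  ext1 a
  rw [vecBlock, dif_pos (by omega), Q13_apply E Ahat c b hb ⟨⟨l, by omega⟩, a⟩ hd]
  rfl

theorem vecBlock_Q13_of_lt {k : ℕ} {t : ℕ → ℕ}
    (E : ∀ i : ℕ, Matrix (Fin (t i)) (Fin (t i)) ℂ)
    (Ahat : ∀ i : ℕ, Matrix (Fin (t (i+1))) (Fin (t (i+1))) ℂ) {i : ℕ}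
    (c : Fin (t i - t (i + 1))) {l : ℕ} (hl : i < l) :
    vecBlock (fun p => Q13 k t E Ahat i p c) l = 0 := by
  ext1 a
  by_cases h : l < k
  · rw [vecBlock, dif_pos h, Q13, Matrix.of_apply, dif_neg (by simpa using hl)]
    rfl
  · exact dif_neg h

theorem pencil_mulVec_Q13 {k : ℕ} {t : ℕ → ℕ}
    {E : ∀ i : ℕ, Matrix (Fin (t i)) (Fin (t i)) ℂ}
    (Ahat : ∀ i : ℕ, Matrix (Fin (t (i+1))) (Fin (t (i+1))) ℂ)
    (hE : ∀ i, IsUpperTri (E i)) {i : ℕ} (hi : i < k)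
    (c : Fin (t i - t (i + 1))) (b : Fin (t i)) (hb : (b : ℕ) = t (i + 1) + c)
    (p : Σ j : Fin k, Fin (t (j : ℕ))) :
    (pencilMat (jordA k t Ahat) (jordE k t E) *ᵥ fun p => Q13 k t E Ahat i p c) p
      = if h : i = (p.1 : ℕ) then X ^ (i + 1) * C (E p.1 p.2 (Fin.cast (congrArg t h) b))
        else 0 := by
  obtain ⟨⟨l, hl⟩, a⟩ := p
  refine (congrFun (pencil_mulVec_block hE _ ⟨l, hl⟩) a).trans ?_
  rcases lt_trichotomy l i with h | rfl | h
  · obtain ⟨d, rfl⟩ : ∃ d, i = l + 1 + d := ⟨i - (l + 1), by omega⟩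
    rw [dif_neg (by simp; omega), vecBlock_Q13 E Ahat hi c b hb (l := l) (d := d + 1) (by omega),
      vecBlock_Q13 E Ahat hi c b hb (l := l + 1) (d := d) rfl,
      zprod_succ_left t E Ahat l d _ rfl]
    have : (X : ℂ[X]) • (X : ℂ[X]) ^ l • (fun a => C ((Zhat13 t E Ahat l *
          zprod t E Ahat (l + 1) d (l + 1 + d) rfl) a b))
        - (Zhat13 t E Ahat l).map C *ᵥ ((X : ℂ[X]) ^ (l + 1) •
          fun a => C (zprod t E Ahat (l + 1) d (l + 1 + d) rfl a b)) = 0 := by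
      ext1 a
      rw [Matrix.mulVec_smul, smul_smul, ← pow_succ', ← smul_sub, Pi.smul_apply, Pi.sub_apply,
        sub_eq_zero.2, smul_zero, Pi.zero_apply]
      simp [Matrix.mul_apply, Matrix.mulVec, dotProduct]
    rw [this, Matrix.mulVec_zero, Pi.zero_apply]
  · rw [dif_pos rfl, vecBlock_Q13 E Ahat hi c b hb (l := l) (d := 0) rfl,
      vecBlock_Q13_of_lt E Ahat c l.lt_succ_self, Matrix.mulVec_zero, sub_zero, smul_smul,
      ← pow_succ', Matrix.mulVec_smul, Pi.smul_apply, smul_eq_mul, zprod_zero]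
    congr 1
    simp [Matrix.mulVec, dotProduct, Matrix.one_apply, apply_ite C]
  · rw [dif_neg (by simpa using h.ne), vecBlock_Q13_of_lt E Ahat c h,
      vecBlock_Q13_of_lt E Ahat c (h.trans l.lt_succ_self)]
    simp

/-- At `0`, the columns of the `Q_i` are the columns of an upper triangular matrix. -/
theorem eval_Q13 {k : ℕ} {t : ℕ → ℕ} (ht : Antitone t)
    {E : ∀ i : ℕ, Matrix (Fin (t i)) (Fin (t i)) ℂ}
    {Ahat : ∀ i : ℕ, Matrix (Fin (t (i+1))) (Fin (t (i+1))) ℂ}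
    (hE : ∀ i, IsUpperTri (E i)) (hA : ∀ i, IsUpperTri (Ahat i)) {i : ℕ}
    (c : Fin (t i - t (i + 1))) (p : Σ j : Fin k, Fin (t (j : ℕ))) :
    (¬((p.1 : ℕ) = 0 ∧ (p.2 : ℕ) ≤ t (i + 1) + c) → (Q13 k t E Ahat i p c).eval 0 = 0) ∧
    ((p.1 : ℕ) = 0 → (p.2 : ℕ) = t (i + 1) + c → (Q13 k t E Ahat i p c).eval 0 ≠ 0) := by
  by_cases hpi : (p.1 : ℕ) ≤ i
  · obtain ⟨d, hd⟩ := Nat.exists_eq_add_of_le hpi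
    rw [Q13_apply E Ahat c ⟨t (i + 1) + c, by omega⟩ rfl p hd, Polynomial.eval_mul,
      Polynomial.eval_pow, Polynomial.eval_X, Polynomial.eval_C, zprod, Matrix.submatrix_apply]
    constructor
    · intro h
      by_cases h0 : (p.1 : ℕ) = 0
      · rw [(isUpperTri_Zp13 ht hE hA p.1 d).1 _ _ (not_le.1 fun h' => h ⟨h0, h'⟩), mul_zero]
      · rw [zero_pow h0, zero_mul]
    · intro h0 h
      refine mul_ne_zero (by simp [h0]) ((isUpperTri_Zp13 ht hE hA p.1 d).2 _ _ h)
  · rw [Q13, Matrix.of_apply, dif_neg hpi]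
    exact ⟨fun _ => Polynomial.eval_zero, fun h => absurd h (by omega)⟩

theorem isZeroDirection_Q13 {k : ℕ} {t : ℕ → ℕ} (ht : Antitone t)
    {E : ∀ i : ℕ, Matrix (Fin (t i)) (Fin (t i)) ℂ}
    {Ahat : ∀ i : ℕ, Matrix (Fin (t (i+1))) (Fin (t (i+1))) ℂ}
    (hE : ∀ i, IsUpperTri (E i)) (hA : ∀ i, IsUpperTri (Ahat i)) (i : Fin k)
    (c : Fin (t (i : ℕ) - t ((i : ℕ) + 1))) :
    IsZeroDirection (pencilMat (jordA k t Ahat) (jordE k t E)) 0 ((i : ℕ) + 1)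
      (fun p => Q13 k t E Ahat (i : ℕ) p c) := by
  have hb : t ((i : ℕ) + 1) + c < t i := by omega
  refine ⟨Nat.succ_pos _, fun h => ?_, fun p => ?_, fun h => ?_⟩
  · exact (eval_Q13 ht hE hA c ⟨⟨0, i.pos⟩, ⟨_, hb.trans_le (ht (Nat.zero_le _))⟩⟩).2 rfl rfl
      (congrFun h _)
  · rw [pencil_mulVec_Q13 Ahat hE i.isLt c ⟨_, hb⟩ rfl, C_0, sub_zero]
    split_ifs
    · exact dvd_mul_right _ _
    · exact dvd_zero _
  · have h1 := h ⟨i, ⟨_, hb⟩⟩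
    rw [pencil_mulVec_Q13 Ahat hE i.isLt c ⟨_, hb⟩ rfl, dif_pos rfl, C_0, sub_zero, pow_succ,
      mul_dvd_mul_iff_left (pow_ne_zero _ Polynomial.X_ne_zero), Polynomial.X_dvd_iff,
      Polynomial.coeff_C_zero] at h1
    exact (hE i).2 _ _ rfl h1

/-- The enumeration of all columns of `Q_k, …, Q_1` in decreasing order of `i`. -/
theorem exists_column_equiv {k : ℕ} {t : ℕ → ℕ} (ht : Antitone t) (htz : ∀ j, k ≤ j → t j = 0) :
    ∃ e : (Σ i : Fin k, Fin (t (i : ℕ) - t ((i : ℕ) + 1))) ≃ Fin (t 0),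
      ∀ s, (e s : ℕ) = t ((s.1 : ℕ) + 1) + s.2 := by
  let f : (Σ i : Fin k, Fin (t (i : ℕ) - t ((i : ℕ) + 1))) → Fin (t 0) := fun s =>
    ⟨t ((s.1 : ℕ) + 1) + s.2, by
      have := ht (Nat.zero_le s.1)
      omega⟩
  refine ⟨Equiv.ofBijective f ⟨?_, fun a => ?_⟩, fun s => rfl⟩
  · rintro ⟨i, c⟩ ⟨j, d⟩ h
    have h' : t ((i : ℕ) + 1) + c = t ((j : ℕ) + 1) + d := congrArg Fin.val h
    obtain rfl : i = j := by
      rcases lt_trichotomy i j with hij | hij | hij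
      · have := ht (show (i : ℕ) + 1 ≤ j from hij)
        omega
      · exact hij
      · have := ht (show (j : ℕ) + 1 ≤ i from hij)
        omega
    obtain rfl : c = d := Fin.ext (by omega)
    rfl
  · have hex : ∃ i, t (i + 1) ≤ (a : ℕ) := ⟨k, by simp [htz _ k.le_succ]⟩
    classical
    have h1 := Nat.find_spec hex
    have h2 : (a : ℕ) < t (Nat.find hex) := by
      rcases h : Nat.find hex with _ | i
      · exact a.isLt
      · exact not_le.1 (Nat.find_min hex (by omega))
    have h3 : Nat.find hex < k := by
      by_contra! h
      rw [htz _ h] at h2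
      exact Nat.not_lt_zero _ h2
    refine ⟨⟨⟨Nat.find hex, h3⟩, ⟨a - t (Nat.find hex + 1), by simp only; omega⟩⟩, Fin.ext ?_⟩
    exact Nat.add_sub_cancel' h1

/-- The first `s` entries of the first block. -/
def headIndices (k : ℕ) (t : ℕ → ℕ) (s : ℕ) : Finset (Σ j : Fin k, Fin (t (j : ℕ))) :=
  Finset.univ.filter fun p => (p.1 : ℕ) = 0 ∧ (p.2 : ℕ) < s

theorem card_headIndices_le (k : ℕ) (t : ℕ → ℕ) (s : ℕ) : (headIndices k t s).card ≤ s := by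
  calc (headIndices k t s).card ≤ (Finset.range s).card := by
        refine Finset.card_le_card_of_injOn (fun p => (p.2 : ℕ)) ?_ ?_
        · intro p hp
          have := (Finset.mem_filter.1 hp).2.2
          simpa using this
        · rintro ⟨⟨i, hi⟩, a⟩ hp ⟨⟨j, hj⟩, b⟩ hq h
          obtain rfl : i = 0 := (Finset.mem_filter.1 hp).2.1
          obtain rfl : j = 0 := (Finset.mem_filter.1 hq).2.1
          obtain rfl : a = b := Fin.ext h
          rfl
    _ = s := Finset.card_range s

theorem rank_le_of_support_head {k : ℕ} {t : ℕ → ℕ} {s n : ℕ}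
    (w : Fin n → (Σ j : Fin k, Fin (t (j : ℕ))) → ℂ)
    (hw : ∀ b p, ¬((p.1 : ℕ) = 0 ∧ (p.2 : ℕ) < s) → w b p = 0) :
    (Matrix.of fun p b => w b p).rank ≤ s := by
  refine (Matrix.rank_le_card_of_support_subset _ (headIndices k t s) ?_).trans
    (card_headIndices_le k t s)
  rw [Function.support_subset_iff']
  intro p hp
  ext b
  exact hw b p fun h => hp (by simpa [headIndices] using h)

theorem linearIndependent_eval_Q13 {k : ℕ} (hk : 1 ≤ k) {t : ℕ → ℕ} (ht : Antitone t)
    {E : ∀ i : ℕ, Matrix (Fin (t i)) (Fin (t i)) ℂ}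
    {Ahat : ∀ i : ℕ, Matrix (Fin (t (i+1))) (Fin (t (i+1))) ℂ}
    (hE : ∀ i, IsUpperTri (E i)) (hA : ∀ i, IsUpperTri (Ahat i))
    (e : (Σ i : Fin k, Fin (t (i : ℕ) - t ((i : ℕ) + 1))) ≃ Fin (t 0))
    (he : ∀ s, (e s : ℕ) = t ((s.1 : ℕ) + 1) + s.2) :
    LinearIndependent ℂ fun (a : Fin (t 0)) (p : Σ j : Fin k, Fin (t (j : ℕ))) =>
      (Q13 k t E Ahat ((e.symm a).1 : ℕ) p (e.symm a).2).eval 0 := by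
  have he' : ∀ a : Fin (t 0), (a : ℕ) = t (((e.symm a).1 : ℕ) + 1) + (e.symm a).2 := fun a => by
    rw [← he, Equiv.apply_symm_apply]
  let T : Matrix (Fin (t 0)) (Fin (t 0)) ℂ := Matrix.of fun b a =>
    (Q13 k t E Ahat ((e.symm a).1 : ℕ) ⟨⟨0, hk⟩, b⟩ (e.symm a).2).eval 0
  have hT : IsUpperTri T :=
    ⟨fun b a h => (eval_Q13 ht hE hA _ _).1 fun h' => by
        have := h'.2
        rw [← he'] at this
        exact absurd this (not_le.2 h),
      fun b a h => (eval_Q13 ht hE hA _ _).2 rfl (h.trans (he' a))⟩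
  exact LinearIndependent.of_comp
    (LinearMap.funLeft ℂ ℂ fun b : Fin (t 0) =>
      (⟨⟨0, hk⟩, b⟩ : Σ j : Fin k, Fin (t (j : ℕ))))
    (Matrix.linearIndependent_cols_of_det_ne_zero hT.det_ne_zero)

/-- The dimensions of the zero spaces of the bidiagonal pencil. -/
theorem finrank_zeroSpace_pencil {k : ℕ} (hk : 1 ≤ k) {t : ℕ → ℕ} (ht : Antitone t)
    (htz : ∀ j, k ≤ j → t j = 0)
    {E : ∀ i : ℕ, Matrix (Fin (t i)) (Fin (t i)) ℂ}
    {Ahat : ∀ i : ℕ, Matrix (Fin (t (i+1))) (Fin (t (i+1))) ℂ}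
    (hE : ∀ i, IsUpperTri (E i)) (hA : ∀ i, IsUpperTri (Ahat i)) (m : ℕ) :
    Module.finrank ℂ (zeroSpace (pencilMat (jordA k t Ahat) (jordE k t E)) (m + 1)) = t m := by
  refine le_antisymm ?_ ?_
  · refine (Submodule.finrank_mono (t := coordSubspace (headIndices k t (t m))) ?_).trans
      ((finrank_coordSubspace _).trans_le (card_headIndices_le k t (t m)))
    rintro v ⟨x, hx, hv⟩ p hp
    rw [hv]
    exact eval_eq_zero_of_dvd_pencil htz ht hE hA hx p
      fun h => hp (by simpa [headIndices] using h)
  · obtain ⟨e, he⟩ := exists_column_equiv ht htz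
    have hli := (linearIndependent_eval_Q13 hk ht hE hA e he).comp
      (Fin.castLE (ht (Nat.zero_le m))) (Fin.castLE_injective _)
    have hmem : ∀ a : Fin (t m), (fun p => (Q13 k t E Ahat
        ((e.symm (Fin.castLE (ht (Nat.zero_le m)) a)).1 : ℕ) p
        (e.symm (Fin.castLE (ht (Nat.zero_le m)) a)).2).eval 0)
        ∈ zeroSpace (pencilMat (jordA k t Ahat) (jordE k t E)) (m + 1) := by
      intro a
      set s := e.symm (Fin.castLE (ht (Nat.zero_le m)) a) with hs
      have hms : m ≤ s.1 := by
        by_contra! h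
        have h1 := ht (show (s.1 : ℕ) + 1 ≤ m from h)
        have h2 := he s
        rw [hs, Equiv.apply_symm_apply, ← hs, Fin.val_castLE] at h2
        omega
      refine ⟨fun p => Q13 k t E Ahat s.1 p s.2, fun p => ?_, fun p => rfl⟩
      have h := (isZeroDirection_Q13 ht hE hA s.1 s.2).2.2.1 p
      rw [C_0, sub_zero] at h
      exact (pow_dvd_pow X (by omega)).trans h
    have hli' : LinearIndependent ℂ fun a : Fin (t m) =>
        (⟨_, hmem a⟩ : zeroSpace (pencilMat (jordA k t Ahat) (jordE k t E)) (m + 1)) :=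
      LinearIndependent.of_comp (Submodule.subtype _) hli
    simpa using hli'.fintype_card_le_finrank

theorem isMaximalFamily_Q13 {k : ℕ} (hk : 1 ≤ k) {t : ℕ → ℕ} (ht : Antitone t)
    (htz : ∀ j, k ≤ j → t j = 0)
    {E : ∀ i : ℕ, Matrix (Fin (t i)) (Fin (t i)) ℂ}
    {Ahat : ∀ i : ℕ, Matrix (Fin (t (i+1))) (Fin (t (i+1))) ℂ}
    (hE : ∀ i, IsUpperTri (E i)) (hA : ∀ i, IsUpperTri (Ahat i))
    (e : (Σ i : Fin k, Fin (t (i : ℕ) - t ((i : ℕ) + 1))) ≃ Fin (t 0))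
    (he : ∀ s, (e s : ℕ) = t ((s.1 : ℕ) + 1) + s.2) :
    IsMaximalFamily (pencilMat (jordA k t Ahat) (jordE k t E)) 0
      (fun a => (((e.symm a).1 : ℕ) + 1))
      (fun a p => Q13 k t E Ahat ((e.symm a).1 : ℕ) p (e.symm a).2) := by
  have hP : (pencilMat (jordA k t Ahat) (jordE k t E)).det ≠ 0 := pencil_det_ne_zero Ahat hE
  have he' : ∀ a : Fin (t 0), (a : ℕ) = t (((e.symm a).1 : ℕ) + 1) + (e.symm a).2 := fun a => by
    rw [← he, Equiv.apply_symm_apply]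
  refine ⟨⟨⟨fun a => ?_, ?_⟩, ?_⟩, ?_, fun a => Nat.succ_pos _, ?_⟩
  · exact (isRootPoly_iff_of_det_ne_zero hP _ _).2 (isZeroDirection_Q13 ht hE hA _ _)
  · rw [forall_isMinimalBasis_rank_iff hP fun a p =>
      (Q13 k t E Ahat ((e.symm a).1 : ℕ) p (e.symm a).2).eval 0]
    rw [← Matrix.rank_transpose]
    exact (linearIndependent_eval_Q13 hk ht hE hA e he).rank_matrix.trans (Fintype.card_fin _)
  · rintro s' k' r' ⟨hroot, hind⟩
    rw [forall_isMinimalBasis_rank_iff hP fun a p => (r' a p).eval 0] at hind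
    rw [← hind]
    refine rank_le_of_support_head _ fun b p hp => ?_
    refine eval_eq_zero_of_dvd_pencil (d := 0) htz ht hE hA (fun q => ?_) p hp
    have h := (hroot b).1.2.2.1 q
    rw [C_0, sub_zero] at h
    exact (pow_dvd_pow X (hroot b).1.1).trans h
  · intro a b hab
    by_contra! h
    have h1 := ht (show ((e.symm a).1 : ℕ) + 1 ≤ (e.symm b).1 by omega)
    have h2 := he' a
    have h3 := he' b
    have h4 : (a : ℕ) ≤ b := hab
    omega
  · intro j k' hk' x hx hrank
    have hrank' := (forall_isMinimalBasis_rank_iff hP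
      (s := (j : ℕ) + 1) fun b p => if h : (b : ℕ) < (j : ℕ) then
        (Q13 k t E Ahat ((e.symm ⟨(b : ℕ), h.trans j.isLt⟩).1 : ℕ) p
          (e.symm ⟨(b : ℕ), h.trans j.isLt⟩).2).eval 0 else (x p).eval 0).1
      fun p N hN => by
        rw [← add_assoc, ← hrank p N hN]
        congr 1
        ext i c
        rcases c with c | c <;> rfl
    have hlt : ¬ (j : ℕ) + 1 ≤ j := by omega
    refine hlt (hrank'.symm.trans_le (rank_le_of_support_head (s := (j : ℕ)) _ fun b p hp => ?_))
    · by_cases h : (b : ℕ) < j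
      · rw [dif_pos h]
        refine (eval_Q13 ht hE hA _ _).1 fun h' => hp ⟨h'.1, h'.2.trans_lt ?_⟩
        rw [← he']
        exact h
      · rw [dif_neg h]
        refine eval_eq_zero_of_dvd_pencil (d := (e.symm j).1 + 1) htz ht hE hA (fun q => ?_) p
          fun h' => hp ⟨h'.1, h'.2.trans_le ?_⟩
        · have h2 := hx.1.2.2.1 q
          rw [C_0, sub_zero] at h2
          exact (pow_dvd_pow X hk').trans h2
        · have := he' j
          omega

/-- Theorem: a maximal set of root polynomials of the regular block
bidiagonal pencil `A₀ + λE₀`. The pencil is regular with `0` as its only finite eigenvalue;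
every column of `Q_i(λ)` is a root polynomial of order `i` at `0` (`1`-based `i`), the
`t_1` columns of `Q_k, …, Q_1` together form a maximal set of root polynomials at `0`, and
the nonzero partial multiplicities at `0` are exactly `i` repeated `t_i − t_{i+1}` times. -/
theorem maximal_set_of_bidiagonal_jordan_pencil
    (k : ℕ) (hk : 1 ≤ k) (t : ℕ → ℕ)
    (htz : ∀ j, k ≤ j → t j = 0)
    (htpos : ∀ i, i < k → 1 ≤ t i)
    (hmono : ∀ i, i + 1 < k → t (i + 1) ≤ t i)
    (E : ∀ i : ℕ, Matrix (Fin (t i)) (Fin (t i)) ℂ)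
    (Ahat : ∀ i : ℕ, Matrix (Fin (t (i+1))) (Fin (t (i+1))) ℂ)
    (hEtri : ∀ i, i < k → ∀ a b : Fin (t i), (b : ℕ) < (a : ℕ) → E i a b = 0)
    (hEdiag : ∀ i, i < k → ∀ a : Fin (t i), E i a a ≠ 0)
    (hAtri : ∀ i, i + 1 < k → ∀ a b : Fin (t (i+1)), (b : ℕ) < (a : ℕ) → Ahat i a b = 0)
    (hAdiag : ∀ i, i + 1 < k → ∀ a : Fin (t (i+1)), Ahat i a a ≠ 0) :
    -- the pencil is regular and its only finite eigenvalue is 0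
    (pencilMat (jordA k t Ahat) (jordE k t E)).det ≠ 0 ∧
    (∃ (c : ℂ) (d : ℕ), c ≠ 0 ∧
      (pencilMat (jordA k t Ahat) (jordE k t E)).det = Polynomial.C c * Polynomial.X ^ d) ∧
    -- every column of `Q_i` is a root polynomial of order `i` at `0` (1-based `i`)
    (∀ (i : Fin k) (c : Fin (t (i : ℕ) - t ((i : ℕ) + 1))),
      IsRootPoly (pencilMat (jordA k t Ahat) (jordE k t E)) 0 ((i : ℕ) + 1)
        (fun p => Q13 k t E Ahat (i : ℕ) p c)) ∧
    -- all the columns together form a maximal set of root polynomials at 0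
    (∃ e : (Σ i : Fin k, Fin (t (i : ℕ) - t ((i : ℕ) + 1))) ≃ Fin (t 0),
      IsMaximalFamily (pencilMat (jordA k t Ahat) (jordE k t E)) 0
        (fun a => (((e.symm a).1 : ℕ) + 1))
        (fun a p => Q13 k t E Ahat ((e.symm a).1 : ℕ) p (e.symm a).2)) ∧
    -- the partial multiplicities at 0: `i` appears `t_{i-1} − t_i` times (1-based `i`)
    (∀ (r : ℕ) (σ : Fin r → ℕ),
      HasPartialMultiplicities (pencilMat (jordA k t Ahat) (jordE k t E)) 0 σ →
      ∀ i : ℕ, 1 ≤ i →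
        (Finset.univ.filter fun a : Fin r => σ a = i).card = t (i - 1) - t i) := by
  have ht : Antitone t := antitone_nat_of_succ_le fun i => by
    rcases lt_or_ge (i + 1) k with h | h
    · exact hmono i h
    · rw [htz _ h]
      exact Nat.zero_le _
  have hE : ∀ i, IsUpperTri (E i) := fun i => by
    rcases lt_or_ge i k with h | h
    · refine ⟨hEtri i h, fun a b hab => ?_⟩
      obtain rfl : a = b := Fin.ext hab
      exact hEdiag i h a
    · have := htz i h
      exact ⟨fun a => absurd a.isLt (by omega), fun a => absurd a.isLt (by omega)⟩
  have hA : ∀ i, IsUpperTri (Ahat i) := fun i => by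
    rcases lt_or_ge (i + 1) k with h | h
    · refine ⟨hAtri i h, fun a b hab => ?_⟩
      obtain rfl : a = b := Fin.ext hab
      exact hAdiag i h a
    · have := htz (i + 1) h
      exact ⟨fun a => absurd a.isLt (by omega), fun a => absurd a.isLt (by omega)⟩
  have hP := pencil_det_ne_zero (k := k) Ahat hE
  refine ⟨hP, ⟨_, _, ?_, pencil_det Ahat hE⟩, fun i c => ?_, ?_, fun r σ hσ i hi => ?_⟩
  · exact Finset.prod_ne_zero_iff.2 fun p _ => (hE p.1).2 p.2 p.2 rfl
  · exact (isRootPoly_iff_of_det_ne_zero hP _ _).2 (isZeroDirection_Q13 ht hE hA i c)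
  · obtain ⟨e, he⟩ := exists_column_equiv ht htz
    exact ⟨e, isMaximalFamily_Q13 hk ht htz hE hA e he⟩
  · obtain ⟨m, rfl⟩ : ∃ m, i = m + 1 := ⟨i - 1, by omega⟩
    have h1 := hσ.card_le_eq_finrank hP (m + 1)
    have h2 := hσ.card_le_eq_finrank hP (m + 1 + 1)
    rw [finrank_zeroSpace_pencil hk ht htz hE hA] at h1 h2
    have hsplit : (Finset.univ.filter fun a : Fin r => m + 1 ≤ σ a)
        = (Finset.univ.filter fun a : Fin r => σ a = m + 1) ∪
          (Finset.univ.filter fun a : Fin r => m + 1 + 1 ≤ σ a) := by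
      ext a
      simp only [Finset.mem_union, Finset.mem_filter_univ]
      omega
    rw [hsplit, Finset.card_union_of_disjoint, h2] at h1
    · simp only [Nat.add_sub_cancel]
      omega
    · refine Finset.disjoint_filter.2 fun a _ ha => ?_
      omega

end
end

section
/- For every matrix pencil L_0+λL_1∈ℂ[λ]^{m×n} there exist invertible matrices Ŝ∈ℂ^{m×m} and T̂∈ℂ^{n×n}, and nonnegative integers m_1,m_2,m_3 with m_1+m_2+m_3=m and n_1,n_3 with n_1+m_2+n_3=n, such that Ŝ^{−1}(L_0+λL_1)T̂ = [[A_ε+λE_ε, 0, X(λ)],[0, A_0+λE_0, Y(λ)],[0, 0, A_r+λE_r]] in conformal block partition, where: A_ε+λE_ε∈ℂ[λ]^{m_1×n_1} satisfies rank_ℂ(A_ε+μE_ε)=m_1 for every μ∈ℂ and rank_ℂ E_ε=m_1 (its Kronecker structure consists only of right minimal indices); A_0+λE_0∈ℂ[λ]^{m_2×m_2} is regular with E_0 invertible and det(A_0+λE_0)=cλ^d for some c≠0 and d≥0 (its only structure is the Jordan structure at the eigenvalue 0); and A_r+λE_r∈ℂ[λ]^{m_3×n_3} satisfies rank_ℂ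 A_r=n_3 (it has no right minimal indices and 0 is not one of its eigenvalues). -/
open Polynomial Matrix

noncomputable section

/-- The `3 × 3` block upper triangular matrix `[[M11, 0, M13], [0, M22, M23], [0, 0, M33]]`
appearing as a coefficient of the transformed pencil. -/
def triBlock {m1 m2 m3 n1 n3 : ℕ}
    (M11 : Matrix (Fin m1) (Fin n1) ℂ) (M22 : Matrix (Fin m2) (Fin m2) ℂ)
    (M33 : Matrix (Fin m3) (Fin n3) ℂ) (M13 : Matrix (Fin m1) (Fin n3) ℂ)
    (M23 : Matrix (Fin m2) (Fin n3) ℂ) :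
    Matrix (Fin m1 ⊕ Fin m2 ⊕ Fin m3) (Fin n1 ⊕ Fin m2 ⊕ Fin n3) ℂ :=
  Matrix.of fun r c =>
    match r, c with
    | Sum.inl i, Sum.inl j => M11 i j
    | Sum.inl i, Sum.inr (Sum.inr j) => M13 i j
    | Sum.inr (Sum.inl i), Sum.inr (Sum.inl j) => M22 i j
    | Sum.inr (Sum.inl i), Sum.inr (Sum.inr j) => M23 i j
    | Sum.inr (Sum.inr i), Sum.inr (Sum.inr j) => M33 i j
    | _, _ => 0

namespace LinearMap

variable {F V W : Type*} [Field F] [AddCommGroup V] [Module F V] [AddCommGroup W] [Module F W]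

/-- Two surjections between the same finite-dimensional spaces differ by an automorphism of the
source. -/
theorem exists_linearEquiv_comp_eq_of_surjective [FiniteDimensional F V] {f g : V →ₗ[F] W}
    (hf : Function.Surjective f) (hg : Function.Surjective g) :
    ∃ e : V ≃ₗ[F] V, ∀ v, g (e v) = f v := by
  obtain ⟨p, hp⟩ := (ker f).exists_isCompl
  obtain ⟨q, hq⟩ := (ker g).exists_isCompl
  have hk : Module.finrank F (ker f) = Module.finrank F (ker g) := by
    have h1 := f.finrank_range_add_finrank_ker
    have h2 := g.finrank_range_add_finrank_ker
    rw [range_eq_top.2 hf] at h1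
    rw [range_eq_top.2 hg] at h2
    omega
  let ef := f.equivProdOfSurjectiveOfIsCompl ((ker f).projectionOnto p hp)
    (range_eq_top.2 hf) (Submodule.range_projectionOnto hp)
    (by rw [Submodule.ker_projectionOnto]; exact hp)
  let eg := g.equivProdOfSurjectiveOfIsCompl ((ker g).projectionOnto q hq)
    (range_eq_top.2 hg) (Submodule.range_projectionOnto hq)
    (by rw [Submodule.ker_projectionOnto]; exact hq)
  refine ⟨ef.trans (((LinearEquiv.refl F W).prodCongr
    (LinearEquiv.ofFinrankEq _ _ hk)).trans eg.symm), fun v => ?_⟩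
  have h : ∀ x, g (eg.symm x) = x.1 := fun x => by
    conv_rhs => rw [← eg.apply_symm_apply x]
    rfl
  simp only [LinearEquiv.trans_apply, h]
  rfl

/-- If `A` and `E` map `U` onto the same subspace and `E` is surjective, then `A` factors
through `E` by an endomorphism that is bijective on `U`. -/
theorem exists_factor_of_map_eq [FiniteDimensional F V] {A E : V →ₗ[F] W}
    (hE : Function.Surjective E) {U : Submodule F V} (hU : U.map A = U.map E) :
    ∃ M : V →ₗ[F] V, (∀ v, E (M v) = A v) ∧ ∃ e : U ≃ₗ[F] U, ∀ u : U, M u = e u := by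
  have hA' : ∀ u ∈ U, A u ∈ U.map E := fun u hu => hU ▸ Submodule.mem_map_of_mem hu
  have hE' : ∀ u ∈ U, E u ∈ U.map E := fun u hu => Submodule.mem_map_of_mem hu
  obtain ⟨e, he⟩ := exists_linearEquiv_comp_eq_of_surjective
    (f := A.restrict hA') (g := E.restrict hE')
    (by
      rintro ⟨w, hw⟩
      obtain ⟨u, hu, rfl⟩ := Submodule.mem_map.1 (hU.symm ▸ hw)
      exact ⟨⟨u, hu⟩, rfl⟩)
    (by
      rintro ⟨w, u, hu, rfl⟩
      exact ⟨⟨u, hu⟩, rfl⟩)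
  obtain ⟨C, hC⟩ := U.exists_isCompl
  obtain ⟨G, hG⟩ := E.exists_rightInverse_of_surjective (range_eq_top.2 hE)
  refine ⟨ofIsCompl hC (U.subtype ∘ₗ e.toLinearMap) (G ∘ₗ A ∘ₗ C.subtype), fun v => ?_, e,
    fun u => by simp⟩
  obtain ⟨⟨u, c⟩, rfl⟩ := (Submodule.prodEquivOfIsCompl U C hC).surjective v
  have h1 : E (e u) = A u := congrArg Subtype.val (he u)
  have h2 : E (G (A c)) = A c := LinearMap.congr_fun hG _
  simp [h1, h2]

/-- A pencil `A + μE` with `E` surjective whose Wong sequence exhausts the source splits as the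
direct sum of a pencil that is surjective for every `μ` and a nilpotent one. -/
theorem exists_splitting_of_wong_eq_top [FiniteDimensional F V] {A E : V →ₗ[F] W}
    (hE : Function.Surjective E)
    (hwong : ∀ P : Submodule F V, (P.map E).comap A ≤ P → P = ⊤) :
    ∃ (U K : Submodule F V) (Z : Submodule F W) (e : (U × K) ≃ₗ[F] V) (f : (Z × K) ≃ₗ[F] W)
      (A₁ E₁ : U →ₗ[F] Z) (N : K →ₗ[F] K), IsNilpotent N ∧
      (∀ u k, A (e (u, k)) = f (A₁ u, N k)) ∧ (∀ u k, E (e (u, k)) = f (E₁ u, k)) ∧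
      (∀ μ : F, Function.Surjective (A₁ + μ • E₁)) ∧ Function.Surjective E₁ := by
  let Φ : Submodule F V →o Submodule F V :=
    ⟨fun P => (P.map A).comap E, fun _ _ h => Submodule.comap_mono (Submodule.map_mono h)⟩
  obtain ⟨U, hΦ, hind⟩ : ∃ U : Submodule F V, (U.map A).comap E = U ∧
      ∀ P : Submodule F V, (P.map A).comap E ≤ P → U ≤ P :=
    ⟨Φ.lfp, Φ.map_lfp, fun _ h => Φ.lfp_le h⟩
  have hAE : U.map A = U.map E := by
    conv_rhs => rw [← hΦ]
    exact (Submodule.map_comap_eq_of_surjective hE _).symm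
  have hker : ∀ v, E v = 0 → v ∈ U := fun v hv => by
    rw [← hΦ, Submodule.mem_comap, hv]
    exact zero_mem _
  have hmemU : ∀ v, E v ∈ U.map E → v ∈ U := fun v hv => by
    rwa [← hΦ, Submodule.mem_comap, hAE]
  obtain ⟨M, hM, m, hm⟩ := exists_factor_of_map_eq hE hAE
  have hMU : ∀ k : ℕ, ∀ u : U, (M ^ k) u = (m.toLinearMap ^ k) u := fun k => by
    induction k with
    | zero => simp
    | succ k ih => intro u; rw [pow_succ, pow_succ, Module.End.mul_apply, hm, ih]; rfl
  obtain ⟨d, hd⟩ : ∃ d : ℕ, ∀ v, (M ^ (d + 1)) v = 0 → (M ^ d) v = 0 :=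
    ⟨Module.finrank F V, fun v hv =>
      Module.End.ker_pow_le_ker_pow_finrank M _ hv⟩
  let K := ker (M ^ d)
  have hdisj : Disjoint U K := by
    rw [Submodule.disjoint_def]
    intro u hu hk
    have h := hMU d ⟨u, hu⟩
    rw [show (M ^ d) u = 0 from hk] at h
    have hinj : Function.Injective (m.toLinearMap ^ d) := by
      rw [Module.End.coe_pow]
      exact m.injective.iterate d
    have h0 : (⟨u, hu⟩ : U) = 0 := hinj (by rw [map_zero]; exact Subtype.ext h.symm)
    exact congrArg Subtype.val h0
  have hsup : U ⊔ K = ⊤ := by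
    refine hwong _ fun v hv => ?_
    obtain ⟨p, hp, hpv⟩ := hv
    obtain ⟨u, hu, k, hk, rfl⟩ := Submodule.mem_sup.1 hp
    have h1 : M v - (u + k) ∈ U := hker _ (by rw [map_sub, hM, hpv, sub_self])
    have h2 : M v - k ∈ U := by
      have := add_mem h1 hu
      rwa [show M v - (u + k) + u = M v - k by abel] at this
    obtain ⟨u', hu'⟩ := m.surjective ⟨_, h2⟩
    have h3 : M u' = M v - k := by rw [hm, hu']
    have h4 : v - u' ∈ K := hd _ (by
      rw [pow_succ, Module.End.mul_apply, map_sub, h3, sub_sub_cancel]; exact hk)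
    exact Submodule.mem_sup.2 ⟨u', u'.2, _, h4, by abel⟩
  have hcompl : IsCompl U K := ⟨hdisj, codisjoint_iff.2 hsup⟩
  have hMK : ∀ k ∈ K, M k ∈ K := fun k hk => by
    change (M ^ d) (M k) = 0
    rw [← Module.End.mul_apply, ← pow_succ, pow_succ', Module.End.mul_apply,
      show (M ^ d) k = 0 from hk, map_zero]
  let f₀ : (U.map E × K) →ₗ[F] W := (U.map E).subtype.coprod (E ∘ₗ K.subtype)
  have hf₀ : Function.Bijective f₀ := by
    constructor
    · rw [← ker_eq_bot, ker_eq_bot']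
      rintro ⟨⟨w, hw⟩, k⟩ h
      have h' : w + E k = 0 := h
      have hkU : (k : V) ∈ U := hmemU _ (by
        rw [eq_neg_of_add_eq_zero_right h']; exact neg_mem hw)
      have hk0 : (k : V) = 0 := Submodule.disjoint_def.1 hdisj _ hkU k.2
      rw [hk0, map_zero, add_zero] at h'
      exact Prod.ext (Subtype.ext h') (Subtype.ext hk0)
    · intro w
      obtain ⟨v, rfl⟩ := hE w
      obtain ⟨⟨u, k⟩, rfl⟩ := (Submodule.prodEquivOfIsCompl U K hcompl).surjective v
      exact ⟨(⟨E u, Submodule.mem_map_of_mem u.2⟩, k), by simp [f₀]⟩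
  have hA' : ∀ u ∈ U, A u ∈ U.map E := fun u hu => hAE ▸ Submodule.mem_map_of_mem hu
  have hE' : ∀ u ∈ U, E u ∈ U.map E := fun u hu => Submodule.mem_map_of_mem hu
  refine ⟨U, K, U.map E, Submodule.prodEquivOfIsCompl U K hcompl, LinearEquiv.ofBijective f₀ hf₀,
    A.restrict hA', E.restrict hE', M.restrict hMK, ⟨d, ?_⟩, ?_, ?_, ?_, ?_⟩
  · ext k
    rw [Module.End.pow_restrict]
    exact k.2
  · intro u k
    simp [f₀, hM]
  · intro u k
    simp [f₀]
  · rintro μ ⟨w, hw⟩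
    have key : U ≤ (U.map (A + μ • E)).comap A ⊓ U := by
      refine hind _ fun v hv => ?_
      obtain ⟨p, ⟨hp, hpU⟩, hpv⟩ := hv
      have hvU : v ∈ U := by
        rw [← hΦ]
        exact ⟨p, hpU, hpv⟩
      refine ⟨?_, hvU⟩
      have h1 : (A + μ • E) v ∈ U.map (A + μ • E) := Submodule.mem_map_of_mem hvU
      have h2 : E v ∈ U.map (A + μ • E) := by rw [← hpv]; exact hp
      have h3 := sub_mem h1 (Submodule.smul_mem _ μ h2)
      simpa using h3
    rw [← hAE] at hw
    obtain ⟨u, hu, rfl⟩ := hw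
    obtain ⟨v, hv, hvu⟩ := (key hu).1
    exact ⟨⟨v, hv⟩, Subtype.ext hvu⟩
  · rintro ⟨w, u, hu, rfl⟩
    exact ⟨⟨u, hu⟩, rfl⟩

/-- Block triangular decomposition of a pencil of linear maps between finite-dimensional spaces. -/
theorem exists_pencil_block_triangular [FiniteDimensional F V] (A E : V →ₗ[F] W) :
    ∃ (V' : Submodule F V) (W' : Submodule F W) (U K : Submodule F V') (Q : Submodule F V)
      (Z : Submodule F W') (R : Submodule F W)
      (e : (U × K × Q) ≃ₗ[F] V) (f : (Z × K × R) ≃ₗ[F] W)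
      (A₁ E₁ : U →ₗ[F] Z) (N : K →ₗ[F] K) (A₃ E₃ : Q →ₗ[F] R) (X₀ X₁ : Q →ₗ[F] Z)
      (Y₀ Y₁ : Q →ₗ[F] K), IsNilpotent N ∧
      (∀ u k q, A (e (u, k, q)) = f (A₁ u + X₀ q, N k + Y₀ q, A₃ q)) ∧
      (∀ u k q, E (e (u, k, q)) = f (E₁ u + X₁ q, k + Y₁ q, E₃ q)) ∧
      (∀ μ : F, Function.Surjective (A₁ + μ • E₁)) ∧ Function.Surjective E₁ ∧
      Function.Injective A₃ := by
  let Φ : Submodule F V →o Submodule F V :=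
    ⟨fun P => (P.map E).comap A, fun _ _ h => Submodule.comap_mono (Submodule.map_mono h)⟩
  obtain ⟨V', hΦ, hind⟩ : ∃ V' : Submodule F V, (V'.map E).comap A = V' ∧
      ∀ P : Submodule F V, (P.map E).comap A ≤ P → V' ≤ P :=
    ⟨Φ.lfp, Φ.map_lfp, fun _ h => Φ.lfp_le h⟩
  have hA' : ∀ v ∈ V', A v ∈ V'.map E := fun v hv => by rwa [← hΦ] at hv
  have hE' : ∀ v ∈ V', E v ∈ V'.map E := fun v hv => Submodule.mem_map_of_mem hv
  obtain ⟨U, K, Z, e, f, A₁, E₁, N, hN, hA, hE, hsurj, hE₁⟩ :=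
    exists_splitting_of_wong_eq_top (A := A.restrict hA') (E := E.restrict hE')
      (by
        rintro ⟨w, v, hv, rfl⟩
        exact ⟨⟨v, hv⟩, rfl⟩)
      (by
        intro P hP
        have h : V' ≤ P.map V'.subtype := by
          refine hind _ fun v hv => ?_
          obtain ⟨p, ⟨p', hp', rfl⟩, hpv⟩ := hv
          have hvV : v ∈ V' := by
            rw [← hΦ]
            exact ⟨p', p'.2, hpv⟩
          exact ⟨⟨v, hvV⟩, hP ⟨p', hp', Subtype.ext hpv⟩, rfl⟩
        rw [eq_top_iff]
        rintro v -
        obtain ⟨p, hp, hpv⟩ := h v.2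
        rwa [← Subtype.ext hpv])
  obtain ⟨Q, hQ⟩ := V'.exists_isCompl
  obtain ⟨R, hR⟩ := (V'.map E).exists_isCompl
  let e' : (U × K × Q) ≃ₗ[F] V := (LinearEquiv.prodAssoc F U K Q).symm.trans
    ((e.prodCongr (LinearEquiv.refl F Q)).trans (Submodule.prodEquivOfIsCompl V' Q hQ))
  let f' : (Z × K × R) ≃ₗ[F] W := (LinearEquiv.prodAssoc F Z K R).symm.trans
    ((f.prodCongr (LinearEquiv.refl F R)).trans (Submodule.prodEquivOfIsCompl _ R hR))
  have he' : ∀ u k q, e' (u, k, q) = e (u, k) + q := fun u k q => by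
    simp [e', LinearEquiv.prodAssoc]
  have hf' : ∀ z k r, f' (z, k, r) = f (z, k) + r := fun z k r => by
    simp [f', LinearEquiv.prodAssoc]
  let p (B : V →ₗ[F] W) : Q →ₗ[F] (Z × K × R) := f'.symm.toLinearMap ∘ₗ B ∘ₗ Q.subtype
  have hp : ∀ (B : V →ₗ[F] W) (q : Q), B q = f' (p B q) := fun B q => by simp [p]
  refine ⟨V', V'.map E, U, K, Q, Z, R, e', f', A₁, E₁, N, snd F K R ∘ₗ snd F Z _ ∘ₗ p A,
    snd F K R ∘ₗ snd F Z _ ∘ₗ p E, fst F Z _ ∘ₗ p A, fst F Z _ ∘ₗ p E,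
    fst F K R ∘ₗ snd F Z _ ∘ₗ p A, fst F K R ∘ₗ snd F Z _ ∘ₗ p E, hN, ?_, ?_, hsurj, hE₁, ?_⟩
  · intro u k q
    have h : A (e (u, k)) = f (A₁ u, N k) := congrArg Subtype.val (hA u k)
    have h' : (A₁ u + (p A q).1, N k + (p A q).2.1, (p A q).2.2) = (A₁ u, N k, 0) + p A q := by
      ext <;> simp
    change _ = f' (A₁ u + (p A q).1, N k + (p A q).2.1, (p A q).2.2)
    rw [he', map_add, h, h', map_add, ← hp, hf']
    simp
  · intro u k q
    have h : E (e (u, k)) = f (E₁ u, k) := congrArg Subtype.val (hE u k)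
    have h' : (E₁ u + (p E q).1, k + (p E q).2.1, (p E q).2.2) = (E₁ u, k, 0) + p E q := by
      ext <;> simp
    change _ = f' (E₁ u + (p E q).1, k + (p E q).2.1, (p E q).2.2)
    rw [he', map_add, h, h', map_add, ← hp, hf']
    simp
  · rw [← ker_eq_bot, ker_eq_bot']
    intro q hq
    have hq' : (p A q).2.2 = 0 := hq
    have hqV : (q : V) ∈ V' := by
      rw [← hΦ, Submodule.mem_comap, hp A q,
        show p A q = ((p A q).1, (p A q).2.1, 0) from Prod.ext rfl (Prod.ext rfl hq'), hf']
      simp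
    exact Subtype.ext (Submodule.disjoint_def.1 hQ.disjoint _ hqV q.2)

variable {ι κ : Type*} [Fintype ι] [DecidableEq ι] [Fintype κ]

theorem rank_toMatrix (b : Module.Basis ι F V) (c : Module.Basis κ F W) (f : V →ₗ[F] W) :
    (toMatrix b c f).rank = Module.finrank F (range f) := by
  rw [Matrix.rank_eq_finrank_range_toLin _ c b, Matrix.toLin_toMatrix]

theorem rank_toMatrix_of_surjective (b : Module.Basis ι F V) (c : Module.Basis κ F W)
    {f : V →ₗ[F] W} (hf : Function.Surjective f) :
    (toMatrix b c f).rank = Fintype.card κ := by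
  rw [rank_toMatrix, range_eq_top.2 hf, finrank_top, Module.finrank_eq_card_basis c]

theorem rank_toMatrix_of_injective (b : Module.Basis ι F V) (c : Module.Basis κ F W)
    {f : V →ₗ[F] W} (hf : Function.Injective f) :
    (toMatrix b c f).rank = Fintype.card ι := by
  rw [rank_toMatrix, finrank_range_of_inj hf, Module.finrank_eq_card_basis b]

theorem bijective_mulVecLin_toMatrix (b : Module.Basis ι F V) (c : Module.Basis κ F W)
    (e : V ≃ₗ[F] W) : Function.Bijective (toMatrix b c e.toLinearMap).mulVecLin := by
  have h : ⇑(toMatrix b c e.toLinearMap).mulVecLin =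
      (b.equivFun.symm.trans (e.trans c.equivFun)) := by
    funext x
    obtain ⟨v, rfl⟩ := b.equivFun.surjective x
    simpa using toMatrix_mulVec_repr b c e.toLinearMap v
  rw [h]
  exact LinearEquiv.bijective _

end LinearMap

/-- The matrix of a block triangular map with respect to product bases. -/
theorem toMatrix_prod_eq_triBlock {V₁ V₂ V₃ W₁ W₃ : Type*} [AddCommGroup V₁] [Module ℂ V₁]
    [AddCommGroup V₂] [Module ℂ V₂] [AddCommGroup V₃] [Module ℂ V₃] [AddCommGroup W₁]
    [Module ℂ W₁] [AddCommGroup W₃] [Module ℂ W₃] {m1 m2 m3 n1 n3 : ℕ}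
    (b₁ : Module.Basis (Fin n1) ℂ V₁) (b₂ : Module.Basis (Fin m2) ℂ V₂)
    (b₃ : Module.Basis (Fin n3) ℂ V₃) (c₁ : Module.Basis (Fin m1) ℂ W₁)
    (c₃ : Module.Basis (Fin m3) ℂ W₃) {g : (V₁ × V₂ × V₃) →ₗ[ℂ] (W₁ × V₂ × W₃)}
    {A : V₁ →ₗ[ℂ] W₁} {N : V₂ →ₗ[ℂ] V₂} {B : V₃ →ₗ[ℂ] W₃} {X : V₃ →ₗ[ℂ] W₁} {Y : V₃ →ₗ[ℂ] V₂}
    (hg : ∀ u k q, g (u, k, q) = (A u + X q, N k + Y q, B q)) :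
    LinearMap.toMatrix (b₁.prod (b₂.prod b₃)) (c₁.prod (b₂.prod c₃)) g =
      triBlock (LinearMap.toMatrix b₁ c₁ A) (LinearMap.toMatrix b₂ b₂ N)
        (LinearMap.toMatrix b₃ c₃ B) (LinearMap.toMatrix b₃ c₁ X)
        (LinearMap.toMatrix b₃ b₂ Y) := by
  ext (i | i | i) (j | j | j) <;>
    simp [triBlock, LinearMap.toMatrix_apply, Module.Basis.prod_apply, hg]

theorem det_pencilMat_one_of_isNilpotent {n : ℕ} {N : Matrix (Fin n) (Fin n) ℂ}
    (hN : IsNilpotent N) : (pencilMat N 1).det = X ^ n := by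
  have h : pencilMat N 1 = (-N).charmatrix := by
    ext1 i j
    by_cases hij : i = j
    · subst hij
      simp [pencilMat, add_comm]
    · simp [pencilMat, hij]
  have hchar := (Matrix.isNilpotent_charpoly_sub_pow_of_isNilpotent hN.neg).eq_zero
  rw [h]
  simpa [sub_eq_zero, Matrix.charpoly] using hchar

/-- A block triangular form of a pair of linear maps yields one of the corresponding matrices. -/
theorem exists_triBlock_of_linearMap {m n : ℕ} {V W U K Q Z R : Type*}
    [AddCommGroup V] [Module ℂ V] [AddCommGroup W] [Module ℂ W] [AddCommGroup U] [Module ℂ U]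
    [FiniteDimensional ℂ U] [AddCommGroup K] [Module ℂ K] [FiniteDimensional ℂ K]
    [AddCommGroup Q] [Module ℂ Q] [FiniteDimensional ℂ Q]
    [AddCommGroup Z] [Module ℂ Z] [FiniteDimensional ℂ Z]
    [AddCommGroup R] [Module ℂ R] [FiniteDimensional ℂ R]
    (v : Module.Basis (Fin n) ℂ V) (w : Module.Basis (Fin m) ℂ W) {A E : V →ₗ[ℂ] W}
    (e : (U × K × Q) ≃ₗ[ℂ] V) (f : (Z × K × R) ≃ₗ[ℂ] W)
    {A₁ E₁ : U →ₗ[ℂ] Z} {N : K →ₗ[ℂ] K} {A₃ E₃ : Q →ₗ[ℂ] R} {X₀ X₁ : Q →ₗ[ℂ] Z}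
    {Y₀ Y₁ : Q →ₗ[ℂ] K} (hN : IsNilpotent N)
    (hA : ∀ u k q, A (e (u, k, q)) = f (A₁ u + X₀ q, N k + Y₀ q, A₃ q))
    (hE : ∀ u k q, E (e (u, k, q)) = f (E₁ u + X₁ q, k + Y₁ q, E₃ q))
    (hsurj : ∀ μ : ℂ, Function.Surjective (A₁ + μ • E₁)) (hE₁ : Function.Surjective E₁)
    (hA₃ : Function.Injective A₃) :
    ∃ (m1 m2 m3 n1 n3 : ℕ), m1 + m2 + m3 = m ∧ n1 + m2 + n3 = n ∧
    ∃ (S : Matrix (Fin m) (Fin m1 ⊕ Fin m2 ⊕ Fin m3) ℂ)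
      (T : Matrix (Fin n) (Fin n1 ⊕ Fin m2 ⊕ Fin n3) ℂ),
      Function.Bijective S.mulVecLin ∧ Function.Bijective T.mulVecLin ∧
    ∃ (Aeps Eeps : Matrix (Fin m1) (Fin n1) ℂ) (A0 E0 : Matrix (Fin m2) (Fin m2) ℂ)
      (Ar Er : Matrix (Fin m3) (Fin n3) ℂ) (X0 X1 : Matrix (Fin m1) (Fin n3) ℂ)
      (Y0 Y1 : Matrix (Fin m2) (Fin n3) ℂ),
      LinearMap.toMatrix v w A * T = S * triBlock Aeps A0 Ar X0 Y0 ∧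
      LinearMap.toMatrix v w E * T = S * triBlock Eeps E0 Er X1 Y1 ∧
      (∀ μ : ℂ, (Matrix.of fun i j => Aeps i j + μ * Eeps i j).rank = m1) ∧
      Eeps.rank = m1 ∧
      IsUnit E0.det ∧
      (∃ (c : ℂ) (d : ℕ), c ≠ 0 ∧
        (pencilMat A0 E0).det = Polynomial.C c * Polynomial.X ^ d) ∧
      Ar.rank = n3 := by
  let bU := Module.finBasis ℂ U
  let bK := Module.finBasis ℂ K
  let bQ := Module.finBasis ℂ Q
  let bZ := Module.finBasis ℂ Z
  let bR := Module.finBasis ℂ R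
  let b := bU.prod (bK.prod bQ)
  let c := bZ.prod (bK.prod bR)
  have hm := f.finrank_eq
  have hn := e.finrank_eq
  simp only [Module.finrank_prod, Module.finrank_eq_card_basis v,
    Module.finrank_eq_card_basis w, Fintype.card_fin] at hm hn
  have hblock : ∀ (L : V →ₗ[ℂ] W) (A : U →ₗ[ℂ] Z) (N : K →ₗ[ℂ] K)
      (B : Q →ₗ[ℂ] R) (X : Q →ₗ[ℂ] Z) (Y : Q →ₗ[ℂ] K),
      (∀ u k q, L (e (u, k, q)) = f (A u + X q, N k + Y q, B q)) →
      LinearMap.toMatrix v w L * LinearMap.toMatrix b v e.toLinearMap =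
        LinearMap.toMatrix c w f.toLinearMap *
          triBlock (LinearMap.toMatrix bU bZ A) (LinearMap.toMatrix bK bK N)
            (LinearMap.toMatrix bQ bR B) (LinearMap.toMatrix bQ bZ X)
            (LinearMap.toMatrix bQ bK Y) := by
    intro L A N B X Y h
    rw [← toMatrix_prod_eq_triBlock bU bK bQ bZ bR
      (g := f.symm.toLinearMap ∘ₗ L ∘ₗ e.toLinearMap) (fun u k q => by
        rw [LinearMap.comp_apply, LinearMap.comp_apply, LinearEquiv.coe_coe, LinearEquiv.coe_coe,
          h, f.symm_apply_apply]), ← LinearMap.toMatrix_comp, ← LinearMap.toMatrix_comp]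
    congr 1
    exact LinearMap.ext fun x => by simp
  refine ⟨Module.finrank ℂ Z, Module.finrank ℂ K, Module.finrank ℂ R, Module.finrank ℂ U,
    Module.finrank ℂ Q, by omega, by omega, LinearMap.toMatrix c w f.toLinearMap,
    LinearMap.toMatrix b v e.toLinearMap,
    LinearMap.bijective_mulVecLin_toMatrix _ _ _, LinearMap.bijective_mulVecLin_toMatrix _ _ _,
    _, _, _, _, _, _, _, _, _, _, hblock A A₁ N A₃ X₀ Y₀ hA,
    hblock E E₁ LinearMap.id E₃ X₁ Y₁ hE, fun μ => ?_, ?_, ?_,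
    ⟨1, Module.finrank ℂ K, one_ne_zero, ?_⟩, ?_⟩
  · have h : (Matrix.of fun i j => LinearMap.toMatrix bU bZ A₁ i j +
        μ * LinearMap.toMatrix bU bZ E₁ i j) = LinearMap.toMatrix bU bZ (A₁ + μ • E₁) := by
      ext i j
      simp
    rw [h, LinearMap.rank_toMatrix_of_surjective bU bZ (hsurj μ), Fintype.card_fin]
  · rw [LinearMap.rank_toMatrix_of_surjective bU bZ hE₁, Fintype.card_fin]
  · simp
  · rw [LinearMap.toMatrix_id, det_pencilMat_one_of_isNilpotent, map_one, one_mul]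
    exact hN.map (LinearMap.toMatrixAlgEquiv bK)
  · rw [LinearMap.rank_toMatrix_of_injective bQ bR hA₃, Fintype.card_fin]

/-- The block triangular form of the matrices of a pencil of linear maps. -/
theorem exists_triBlock_toMatrix {m n : ℕ} {V W : Type*} [AddCommGroup V] [Module ℂ V]
    [AddCommGroup W] [Module ℂ W] (v : Module.Basis (Fin n) ℂ V) (w : Module.Basis (Fin m) ℂ W)
    (A E : V →ₗ[ℂ] W) :
    ∃ (m1 m2 m3 n1 n3 : ℕ), m1 + m2 + m3 = m ∧ n1 + m2 + n3 = n ∧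
    ∃ (S : Matrix (Fin m) (Fin m1 ⊕ Fin m2 ⊕ Fin m3) ℂ)
      (T : Matrix (Fin n) (Fin n1 ⊕ Fin m2 ⊕ Fin n3) ℂ),
      Function.Bijective S.mulVecLin ∧ Function.Bijective T.mulVecLin ∧
    ∃ (Aeps Eeps : Matrix (Fin m1) (Fin n1) ℂ) (A0 E0 : Matrix (Fin m2) (Fin m2) ℂ)
      (Ar Er : Matrix (Fin m3) (Fin n3) ℂ) (X0 X1 : Matrix (Fin m1) (Fin n3) ℂ)
      (Y0 Y1 : Matrix (Fin m2) (Fin n3) ℂ),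
      LinearMap.toMatrix v w A * T = S * triBlock Aeps A0 Ar X0 Y0 ∧
      LinearMap.toMatrix v w E * T = S * triBlock Eeps E0 Er X1 Y1 ∧
      (∀ μ : ℂ, (Matrix.of fun i j => Aeps i j + μ * Eeps i j).rank = m1) ∧
      Eeps.rank = m1 ∧
      IsUnit E0.det ∧
      (∃ (c : ℂ) (d : ℕ), c ≠ 0 ∧
        (pencilMat A0 E0).det = Polynomial.C c * Polynomial.X ^ d) ∧
      Ar.rank = n3 := by
  have : FiniteDimensional ℂ V := v.finiteDimensional_of_finite
  have : FiniteDimensional ℂ W := w.finiteDimensional_of_finite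
  obtain ⟨_, _, U, K, Q, Z, R, e, f, A₁, E₁, N, A₃, E₃, X₀, X₁, Y₀, Y₁, hN, hA, hE, hsurj, hE₁,
    hA₃⟩ := LinearMap.exists_pencil_block_triangular A E
  exact exists_triBlock_of_linearMap v w e f hN hA hE hsurj hE₁ hA₃

/-- Every pencil `L₀ + λL₁` admits invertible `Ŝ`, `T̂` such that
`Ŝ⁻¹(L₀ + λL₁)T̂ = [[A_ε + λE_ε, 0, X(λ)], [0, A₀ + λE₀, Y(λ)], [0, 0, A_r + λE_r]]`, where
`A_ε + λE_ε` has full row rank for every `μ ∈ ℂ` as well as at infinity (only right minimal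
indices), `A₀ + λE₀` is regular with `E₀` invertible and `det(A₀ + λE₀) = cλ^d` (only the
Jordan structure at `0`), and `A_r` has full column rank (no right minimal indices and `0`
not an eigenvalue). -/
theorem pencil_block_triangular_decomposition
    {m n : ℕ} (L0 L1 : Matrix (Fin m) (Fin n) ℂ) :
    ∃ (m1 m2 m3 n1 n3 : ℕ), m1 + m2 + m3 = m ∧ n1 + m2 + n3 = n ∧
    ∃ (S : Matrix (Fin m) (Fin m1 ⊕ Fin m2 ⊕ Fin m3) ℂ)
      (T : Matrix (Fin n) (Fin n1 ⊕ Fin m2 ⊕ Fin n3) ℂ),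
      Function.Bijective S.mulVecLin ∧ Function.Bijective T.mulVecLin ∧
    ∃ (Aeps Eeps : Matrix (Fin m1) (Fin n1) ℂ) (A0 E0 : Matrix (Fin m2) (Fin m2) ℂ)
      (Ar Er : Matrix (Fin m3) (Fin n3) ℂ) (X0 X1 : Matrix (Fin m1) (Fin n3) ℂ)
      (Y0 Y1 : Matrix (Fin m2) (Fin n3) ℂ),
      L0 * T = S * triBlock Aeps A0 Ar X0 Y0 ∧
      L1 * T = S * triBlock Eeps E0 Er X1 Y1 ∧
      (∀ μ : ℂ, (Matrix.of fun i j => Aeps i j + μ * Eeps i j).rank = m1) ∧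
      Eeps.rank = m1 ∧
      IsUnit E0.det ∧
      (∃ (c : ℂ) (d : ℕ), c ≠ 0 ∧
        (pencilMat A0 E0).det = Polynomial.C c * Polynomial.X ^ d) ∧
      Ar.rank = n3 := by
  have hL : ∀ L : Matrix (Fin m) (Fin n) ℂ,
      LinearMap.toMatrix (Pi.basisFun ℂ _) (Pi.basisFun ℂ _) L.mulVecLin = L := fun L => by
    rw [← Matrix.toLin'_apply', ← Matrix.toLin_eq_toLin', LinearMap.toMatrix_toLin]
  have h := exists_triBlock_toMatrix (Pi.basisFun ℂ _) (Pi.basisFun ℂ _)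
    L0.mulVecLin L1.mulVecLin
  rwa [hL, hL] at h

end
end
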